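/- arXiv:math/0204251 — 9 statements merged into one kernel-verified Lean document; each statement's English description precedes it below -/
import Mathlib

section
/- For every ε > 0 there exists a constant C(ε) > 0 such that for every finite field F of characteristic greater than 2 and every Besicovitch set P ⊆ F^4, one has |P| ≥ C(ε)⁻¹ · |F|^(3 + 1/16 − ε). -/
open Set

/-- A line in `F^n`: a set of the form `{x + t • v : t ∈ F}` with `v ≠ 0`. -/
def IsLine (F : Type*) [Field F] {n : ℕ} (l : Set (Fin n → F)) : Prop :=
  ∃ x v : Fin n → F, v ≠ 0 ∧ l = {y | ∃ t : F, y = x + t • v}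

/-- A `k`-dimensional affine subspace of `F^n`: a translate of a `k`-dimensional
linear subspace. -/
def IsAffineDim (F : Type*) [Field F] {n : ℕ} (k : ℕ) (V : Set (Fin n → F)) : Prop :=
  ∃ (W : Submodule F (Fin n → F)) (x : Fin n → F),
    Module.finrank F W = k ∧ V = (fun w => x + w) '' (W : Set (Fin n → F))

/-- `B` is a translate of `A`. -/
def IsTranslate (F : Type*) [Field F] {n : ℕ} (A B : Set (Fin n → F)) : Prop :=
  ∃ c : Fin n → F, B = (fun x => x + c) '' A

/-- A family of lines points in different directions: no two of its (distinct)
members are translates of one another. -/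
def DiffDirections (F : Type*) [Field F] {n : ℕ} (L : Set (Set (Fin n → F))) : Prop :=
  ∀ l₁ ∈ L, ∀ l₂ ∈ L, l₁ ≠ l₂ → ¬ IsTranslate F l₁ l₂

/-- Two lines are skew if they are not contained in a common 2-dimensional affine
subspace. -/
def SkewLines (F : Type*) [Field F] {n : ℕ} (l₁ l₂ : Set (Fin n → F)) : Prop :=
  ¬ ∃ V : Set (Fin n → F), IsAffineDim F 2 V ∧ l₁ ⊆ V ∧ l₂ ⊆ V

/-- A frame in `F^4`: a 3-dimensional affine subspace `lam` together with three
pairwise skew lines contained in it. -/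
def IsFrame (F : Type*) [Field F] (l₁ l₂ l₃ lam : Set (Fin 4 → F)) : Prop :=
  IsLine F l₁ ∧ IsLine F l₂ ∧ IsLine F l₃ ∧ IsAffineDim F 3 lam ∧
  l₁ ⊆ lam ∧ l₂ ⊆ lam ∧ l₃ ⊆ lam ∧
  SkewLines F l₁ l₂ ∧ SkewLines F l₁ l₃ ∧ SkewLines F l₂ l₃

/-- The set `L(f)` of all lines of `F^4` intersecting each of `l₁`, `l₂`, `l₃`. -/
def frameLines (F : Type*) [Field F] (l₁ l₂ l₃ : Set (Fin 4 → F)) :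
    Set (Set (Fin 4 → F)) :=
  {l | IsLine F l ∧ (l ∩ l₁).Nonempty ∧ (l ∩ l₂).Nonempty ∧ (l ∩ l₃).Nonempty}

/-- The regulus `r(f)`: the union of the lines in `L(f)`. -/
def regulus (F : Type*) [Field F] (l₁ l₂ l₃ : Set (Fin 4 → F)) : Set (Fin 4 → F) :=
  ⋃ l ∈ frameLines F l₁ l₂ l₃, l

noncomputable section KakeyaAux

open MvPolynomial

variable {F : Type} [Field F]

/-- restriction of a polynomial to a line -/
def lineRes (x v : Fin 4 → F) (p : MvPolynomial (Fin 4) F) : Polynomial F :=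
  MvPolynomial.eval₂ Polynomial.C
    (fun i => Polynomial.C (v i) * Polynomial.X + Polynomial.C (x i)) p

lemma lineRes_eval (x v : Fin 4 → F) (p : MvPolynomial (Fin 4) F) (t : F) :
    (lineRes x v p).eval t = MvPolynomial.eval (x + t • v) p := by
  have h := MvPolynomial.hom_eval₂ p Polynomial.C (Polynomial.evalRingHom t)
    (fun i => Polynomial.C (v i) * Polynomial.X + Polynomial.C (x i))
  rw [Polynomial.coe_evalRingHom] at h
  rw [lineRes, h, MvPolynomial.eval, MvPolynomial.coe_eval₂Hom]
  congr 1
  · ext a; simp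
  · funext i; simp; ring

/-- the image of a monomial -/
def monRes (x v : Fin 4 → F) (s : Fin 4 →₀ ℕ) : Polynomial F :=
  ∏ i, (Polynomial.C (v i) * Polynomial.X + Polynomial.C (x i)) ^ s i

lemma monRes_pow_deg (a b : F) (n : ℕ) :
    ((Polynomial.C a * Polynomial.X + Polynomial.C b) ^ n).natDegree ≤ n := by
  simpa using Polynomial.natDegree_pow_le_of_le n (Polynomial.natDegree_linear_le (a := a) (b := b))

lemma monRes_aux (x v : Fin 4 → F) (s : Fin 4 →₀ ℕ) (S : Finset (Fin 4)) :
    (∏ i ∈ S, (Polynomial.C (v i) * Polynomial.X + Polynomial.C (x i)) ^ s i).natDegree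
        ≤ ∑ i ∈ S, s i ∧
    (∏ i ∈ S, (Polynomial.C (v i) * Polynomial.X + Polynomial.C (x i)) ^ s i).coeff
        (∑ i ∈ S, s i) = ∏ i ∈ S, v i ^ s i := by
  classical
  induction S using Finset.induction_on with
  | empty => simp
  | insert a S ha ih =>
    rw [Finset.prod_insert ha, Finset.sum_insert ha, Finset.prod_insert ha]
    refine ⟨Polynomial.natDegree_mul_le_of_le (monRes_pow_deg _ _ _) ih.1, ?_⟩
    rw [Polynomial.coeff_mul_add_eq_of_natDegree_le (monRes_pow_deg _ _ _) ih.1, ih.2]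
    congr 1
    have := Polynomial.coeff_pow_of_natDegree_le (m := s a) (n := 1)
      (Polynomial.natDegree_linear_le (a := v a) (b := x a))
    simpa using this

lemma monRes_coeff (x v : Fin 4 → F) (s : Fin 4 →₀ ℕ) (d : ℕ) (hd : s.degree ≤ d) :
    (monRes x v s).coeff d = if s.degree = d then ∏ i, v i ^ s i else 0 := by
  have h := monRes_aux x v s Finset.univ
  rw [← Finsupp.degree_eq_sum] at h
  split_ifs with e
  · subst e; exact h.2
  · exact Polynomial.coeff_eq_zero_of_natDegree_lt (lt_of_le_of_lt h.1 (lt_of_le_of_ne hd e))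

lemma lineRes_eq (x v : Fin 4 → F) (p : MvPolynomial (Fin 4) F) :
    lineRes x v p = ∑ s ∈ p.support, Polynomial.C (p.coeff s) * monRes x v s := by
  rw [lineRes, MvPolynomial.eval₂_eq']; rfl

lemma deg_le_of_mem (p : MvPolynomial (Fin 4) F) {s} (hs : s ∈ p.support) :
    s.degree ≤ p.totalDegree := by
  exact MvPolynomial.le_totalDegree hs

lemma lineRes_natDegree (x v : Fin 4 → F) (p : MvPolynomial (Fin 4) F) :
    (lineRes x v p).natDegree ≤ p.totalDegree := by
  rw [lineRes_eq]
  refine Polynomial.natDegree_sum_le_of_forall_le _ _ fun s hs => ?_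
  refine (Polynomial.natDegree_C_mul_le _ _).trans ?_
  have h := (monRes_aux x v s Finset.univ).1
  rw [← Finsupp.degree_eq_sum] at h
  exact h.trans (deg_le_of_mem p hs)

lemma lineRes_coeff (x v : Fin 4 → F) (p : MvPolynomial (Fin 4) F) :
    (lineRes x v p).coeff p.totalDegree
      = MvPolynomial.eval v (homogeneousComponent p.totalDegree p) := by
  rw [lineRes_eq, Polynomial.finsetSum_coeff, homogeneousComponent_apply, map_sum,
    Finset.sum_filter]
  refine Finset.sum_congr rfl fun s hs => ?_
  rw [Polynomial.coeff_C_mul, monRes_coeff _ _ _ _ (deg_le_of_mem p hs)]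
  split_ifs with e
  · rw [MvPolynomial.eval_monomial, Finsupp.prod_fintype _ _ (by simp)]
  · simp

lemma homComp_ne_zero (p : MvPolynomial (Fin 4) F) (hp : p ≠ 0) :
    homogeneousComponent p.totalDegree p ≠ 0 := by
  obtain ⟨s, hs, h⟩ := Finset.exists_mem_eq_sup p.support
    (MvPolynomial.support_nonempty.2 hp) (fun s => s.sum fun _ e => e)
  have h' : s.degree = p.totalDegree := h.symm
  intro h0
  have h1 := coeff_homogeneousComponent (φ := p) p.totalDegree s
  rw [h0, if_pos h'] at h1
  exact MvPolynomial.mem_support_iff.1 hs h1.symm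

lemma no_poly [Fintype F] (P : Set (Fin 4 → F))
    (hP : ∀ v : Fin 4 → F, v ≠ 0 → ∃ x : Fin 4 → F, {y | ∃ t : F, y = x + t • v} ⊆ P)
    (p : MvPolynomial (Fin 4) F) (hd : p.totalDegree < Fintype.card F)
    (h0 : ∀ y ∈ P, MvPolynomial.eval y p = 0) : p = 0 := by
  by_contra hp
  have key : ∀ v : Fin 4 → F, v ≠ 0 →
      MvPolynomial.eval v (homogeneousComponent p.totalDegree p) = 0 := by
    intro v hv
    obtain ⟨x, hx⟩ := hP v hv
    rw [← lineRes_coeff x v p]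
    have : lineRes x v p = 0 := by
      refine Polynomial.eq_zero_of_natDegree_lt_card_of_eval_eq_zero _
        (f := fun t : F => t) Function.injective_id (fun t => ?_)
        (lt_of_le_of_lt (lineRes_natDegree x v p) hd)
      rw [lineRes_eval]
      exact h0 _ (hx ⟨t, rfl⟩)
    rw [this]; simp
  have hhom := homogeneousComponent_isHomogeneous p.totalDegree p
  refine homComp_ne_zero p hp (hhom.eq_zero_of_forall_eval_eq_zero_of_le_card ?_ ?_)
  · intro v
    by_cases hv : v = 0
    · subst hv
      by_cases hz : p.totalDegree = 0
      · have h1 := key 1 (by simp)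
        rw [hz, homogeneousComponent_zero] at h1 ⊢
        simpa using h1
      · rw [MvPolynomial.eval_zero]
        rw [MvPolynomial.constantCoeff_eq, coeff_homogeneousComponent]
        simp [Ne.symm hz]
    · exact key v hv
  · rw [Cardinal.mk_fintype]; exact_mod_cast hd.le

/-- exponent vector -/
def expo (k : ℕ) (a : Fin 4 → Fin k) : Fin 4 →₀ ℕ :=
  Finsupp.equivFunOnFinite.symm (fun i => (a i : ℕ))

lemma expo_inj (k : ℕ) : Function.Injective (expo k) := by
  intro a b h
  have := Finsupp.equivFunOnFinite.symm.injective h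
  funext i
  exact Fin.ext (congrFun this i)

/-- polynomial with given coefficients -/
def mkPoly (k : ℕ) : ((Fin 4 → Fin k) → F) →ₗ[F] MvPolynomial (Fin 4) F :=
  Fintype.linearCombination F (fun a => MvPolynomial.monomial (expo k a) (1 : F))

lemma mkPoly_coeff (k : ℕ) (c : (Fin 4 → Fin k) → F) (a : Fin 4 → Fin k) :
    (mkPoly k c).coeff (expo k a) = c a := by
  classical
  simp [mkPoly, Fintype.linearCombination_apply, MvPolynomial.coeff_sum,
    MvPolynomial.coeff_monomial, (expo_inj k).eq_iff]

lemma mkPoly_deg (k : ℕ) (c : (Fin 4 → Fin k) → F) :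
    (mkPoly k c).totalDegree ≤ 4 * (k - 1) := by
  rw [mkPoly, Fintype.linearCombination_apply]
  refine MvPolynomial.totalDegree_finsetSum_le fun a _ => ?_
  refine (MvPolynomial.totalDegree_smul_le _ _).trans ?_
  refine (MvPolynomial.totalDegree_monomial_le _ _).trans ?_
  rw [Finsupp.sum_fintype _ _ (by simp)]
  refine (Finset.sum_le_card_nsmul Finset.univ _ (k - 1) fun i _ => ?_).trans (by simp)
  have := (a i).2
  change (a i : ℕ) ≤ k - 1
  omega

lemma kakeya_card [Fintype F] (P : Set (Fin 4 → F))
    (hP : ∀ v : Fin 4 → F, v ≠ 0 → ∃ x : Fin 4 → F, {y | ∃ t : F, y = x + t • v} ⊆ P)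
    (k : ℕ) (hk : 4 * (k - 1) < Fintype.card F) : k ^ 4 ≤ P.ncard := by
  classical
  by_contra! hlt
  have : Fintype P := Fintype.ofFinite P
  let L : ((Fin 4 → Fin k) → F) →ₗ[F] (P → F) :=
    (LinearMap.funLeft F F (Subtype.val : P → (Fin 4 → F))) ∘ₗ
      (MvPolynomial.evalₗ F (Fin 4)) ∘ₗ mkPoly k
  have hker : LinearMap.ker L ≠ ⊥ := by
    apply LinearMap.ker_ne_bot_of_finrank_lt
    rw [Module.finrank_fintype_fun_eq_card, Module.finrank_fintype_fun_eq_card]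
    rw [← Nat.card_coe_set_eq, Nat.card_eq_fintype_card] at hlt
    simpa using hlt
  obtain ⟨c, hc, hc0⟩ := (Submodule.ne_bot_iff _).1 hker
  have hz := no_poly P hP (mkPoly k c) ((mkPoly_deg k c).trans_lt hk) (by
    intro y hy
    exact congrFun (LinearMap.mem_ker.1 hc) ⟨y, hy⟩)
  apply hc0
  funext a
  rw [← mkPoly_coeff k c a, hz]; simp

end KakeyaAux

/-- For every ε > 0 there is C(ε) > 0 such that every Besicovitch set
`P ⊆ F^4` over a finite field `F` of characteristic `> 2` satisfies
`|P| ≥ C⁻¹ · |F|^(3 + 1/16 − ε)`. -/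
theorem besicovitch_four_dim_bound :
    ∀ ε : ℝ, 0 < ε → ∃ C : ℝ, 0 < C ∧
      ∀ (F : Type) [Field F] [Fintype F], 2 < ringChar F →
        ∀ P : Set (Fin 4 → F),
          (∀ v : Fin 4 → F, v ≠ 0 →
            ∃ x : Fin 4 → F, {y | ∃ t : F, y = x + t • v} ⊆ P) →
          C⁻¹ * (Fintype.card F : ℝ) ^ ((3 : ℝ) + 1 / 16 - ε) ≤ (P.ncard : ℝ) := by
  intro ε hε
  refine ⟨256, by norm_num, ?_⟩
  intro F _ _ _ P hP
  set q := Fintype.card F with hq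
  have hq1 : 1 ≤ q := Fintype.card_pos
  have h := kakeya_card P hP ((q + 3) / 4) (by omega)
  have hk : q ≤ 4 * ((q + 3) / 4) := by omega
  have h2 : q ^ 4 ≤ 256 * P.ncard := by
    calc q ^ 4 ≤ (4 * ((q + 3) / 4)) ^ 4 := Nat.pow_le_pow_left hk 4
      _ = 256 * ((q + 3) / 4) ^ 4 := by rw [mul_pow]; norm_num
      _ ≤ _ := Nat.mul_le_mul_left _ h
  have h3 : (q : ℝ) ^ 4 ≤ 256 * P.ncard := by exact_mod_cast h2
  have h4 : (q : ℝ) ^ ((3 : ℝ) + 1 / 16 - ε) ≤ (q : ℝ) ^ (4 : ℝ) :=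
    Real.rpow_le_rpow_of_exponent_le (by exact_mod_cast hq1) (by linarith)
  have h5 : (q : ℝ) ^ (4 : ℝ) = (q : ℝ) ^ 4 := by exact_mod_cast Real.rpow_natCast (q : ℝ) 4
  rw [h5] at h4
  linarith
end

section
/- For every n ≥ 2 there exists a constant c = c(n) > 0 such that for every finite field F of characteristic greater than 2 and every Besicovitch set P ⊆ F^n, one has |P| ≥ c·|F|^((n+2)/2). -/
open Set

lemma kak_prod_aux {F ι : Type} [Field F] (S : Finset ι) (e : ι → ℕ) (x v : ι → F) :
    (∏ i ∈ S, (Polynomial.C (x i) + Polynomial.C (v i) * Polynomial.X) ^ e i).natDegree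
      ≤ ∑ i ∈ S, e i ∧
    (∏ i ∈ S, (Polynomial.C (x i) + Polynomial.C (v i) * Polynomial.X) ^ e i).coeff (∑ i ∈ S, e i)
      = ∏ i ∈ S, v i ^ e i := by
  classical
  have h1 : ∀ i, (Polynomial.C (x i) + Polynomial.C (v i) * Polynomial.X).natDegree ≤ 1 := by
    intro i; compute_degree
  have h2 : ∀ i, ((Polynomial.C (x i) + Polynomial.C (v i) * Polynomial.X) ^ e i).natDegree
      ≤ e i := by
    intro i
    simpa using Polynomial.natDegree_pow_le_of_le (e i) (h1 i)
  have h3 : ∀ i, ((Polynomial.C (x i) + Polynomial.C (v i) * Polynomial.X) ^ e i).coeff (e i)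
      = v i ^ e i := by
    intro i
    have := Polynomial.coeff_pow_of_natDegree_le (m := e i) (h1 i)
    simpa [Polynomial.coeff_C] using this
  induction S using Finset.induction_on with
  | empty => simp
  | insert a S ha ih =>
    rw [Finset.prod_insert ha, Finset.sum_insert ha, Finset.prod_insert ha]
    refine ⟨Polynomial.natDegree_mul_le_of_le (h2 a) ih.1, ?_⟩
    rw [Polynomial.coeff_mul_add_eq_of_natDegree_le (h2 a) ih.1, h3, ih.2]

lemma kak_line {F : Type} [Field F] {n : ℕ} (p : MvPolynomial (Fin n) F) (x v : Fin n → F) :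
    ∃ g : Polynomial F, g.natDegree ≤ p.totalDegree ∧
      g.coeff p.totalDegree =
        MvPolynomial.eval v (MvPolynomial.homogeneousComponent p.totalDegree p) ∧
      ∀ t, g.eval t = MvPolynomial.eval (x + t • v) p := by
  classical
  have hdeg : ∀ s ∈ p.support, ∑ i, s i ≤ p.totalDegree := by
    intro s hs
    have := MvPolynomial.le_totalDegree hs
    rwa [Finsupp.sum_fintype _ _ (by simp)] at this
  refine ⟨∑ s ∈ p.support, Polynomial.C (p.coeff s) *
    ∏ i, (Polynomial.C (x i) + Polynomial.C (v i) * Polynomial.X) ^ s i, ?_, ?_, ?_⟩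
  · refine Polynomial.natDegree_sum_le_of_forall_le _ _ fun s hs => ?_
    exact (Polynomial.natDegree_C_mul_le _ _).trans
      ((kak_prod_aux Finset.univ s x v).1.trans (hdeg s hs))
  · rw [Polynomial.finsetSum_coeff, MvPolynomial.homogeneousComponent_apply, map_sum,
      Finset.sum_filter]
    refine Finset.sum_congr rfl fun s hs => ?_
    have h := kak_prod_aux Finset.univ s x v
    rw [Polynomial.coeff_C_mul]
    have hd : s.degree = ∑ i, s i := by
      rw [Finsupp.degree_eq_sum]
    split_ifs with hh
    · rw [← hh, hd, h.2, MvPolynomial.eval_monomial, Finsupp.prod_fintype _ _ (by simp)]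
    · rw [Polynomial.coeff_eq_zero_of_natDegree_lt, mul_zero]
      have := hdeg s hs
      have := h.1
      omega
  · intro t
    rw [MvPolynomial.eval_eq', Polynomial.eval_finsetSum]
    refine Finset.sum_congr rfl fun s hs => ?_
    simp only [Polynomial.eval_mul, Polynomial.eval_C, Polynomial.eval_prod, Polynomial.eval_pow,
      Polynomial.eval_add, Polynomial.eval_X, Pi.add_apply, Pi.smul_apply, smul_eq_mul]
    simp only [mul_comm t]

lemma kak_zero {F : Type} [Field F] [Fintype F] {n : ℕ} (hn : 0 < n)
    (p : MvPolynomial (Fin n) F) (hd : p.totalDegree < Fintype.card F) (P : Set (Fin n → F))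
    (hP : ∀ v : Fin n → F, v ≠ 0 → ∃ x : Fin n → F, {y | ∃ t : F, y = x + t • v} ⊆ P)
    (hp : ∀ y ∈ P, MvPolynomial.eval y p = 0) : p = 0 := by
  classical
  by_contra hne
  have hv : ∀ v : Fin n → F, v ≠ 0 →
      MvPolynomial.eval v (MvPolynomial.homogeneousComponent p.totalDegree p) = 0 := by
    intro v hv
    obtain ⟨x, hx⟩ := hP v hv
    obtain ⟨g, hg1, hg2, hg3⟩ := kak_line p x v
    have hg0 : g = 0 := by
      apply Polynomial.eq_zero_of_natDegree_lt_card_of_eval_eq_zero g (f := (id : F → F))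
        Function.injective_id
      · intro t
        rw [id, hg3]
        exact hp _ (hx ⟨t, rfl⟩)
      · omega
    rw [← hg2, hg0, Polynomial.coeff_zero]
  have hv0 : MvPolynomial.eval 0 (MvPolynomial.homogeneousComponent p.totalDegree p) = 0 := by
    by_cases h0 : p.totalDegree = 0
    · have h1 := hv 1 (by
        intro h
        have := congrFun h ⟨0, hn⟩
        simp at this)
      rw [h0, MvPolynomial.homogeneousComponent_zero] at h1 ⊢
      simpa using h1
    · have hh := MvPolynomial.homogeneousComponent_isHomogeneous p.totalDegree p
      have := hh.coeff_eq_zero (d := 0) (by simpa using Ne.symm h0)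
      rw [← MvPolynomial.constantCoeff_eq] at this
      simpa [MvPolynomial.eval_zero] using this
  have hz : MvPolynomial.homogeneousComponent p.totalDegree p = 0 := by
    apply (MvPolynomial.homogeneousComponent_isHomogeneous p.totalDegree p).eq_zero_of_forall_eval_eq_zero_of_le_card
    · intro v
      by_cases h : v = 0
      · rw [h, hv0]
      · exact hv v h
    · simpa using hd.le
  obtain ⟨s, hs, hs'⟩ := Finset.exists_mem_eq_sup p.support
    (MvPolynomial.support_nonempty.2 hne) (fun s => s.sum fun _ e => e)
  have := congrArg (MvPolynomial.coeff s) hz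
  rw [MvPolynomial.coeff_homogeneousComponent, if_pos] at this
  · exact (MvPolynomial.mem_support_iff.1 hs) (by simpa using this)
  · rw [MvPolynomial.totalDegree, hs']; rfl

lemma kak_bound {F : Type} [Field F] [Fintype F] {n : ℕ} (hn : 0 < n) (P : Set (Fin n → F))
    (hP : ∀ v : Fin n → F, v ≠ 0 → ∃ x : Fin n → F, {y | ∃ t : F, y = x + t • v} ⊆ P)
    (m : ℕ) (hm : n * m < Fintype.card F) : (m + 1) ^ n ≤ P.ncard := by
  classical
  by_contra hlt
  let s : (Fin n → Fin (m + 1)) → (Fin n →₀ ℕ) := fun a =>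
    Finsupp.equivFunOnFinite.symm (fun i => (a i : ℕ))
  have hs : Function.Injective s := by
    intro a b hab
    ext i
    exact DFunLike.congr_fun hab i
  let M : (Fin n → Fin (m + 1)) → (P → F) := fun a y => ∏ i, y.1 i ^ (a i : ℕ)
  have hdep : ¬ LinearIndependent F M := by
    intro h
    have := h.fintype_card_le_finrank
    rw [Module.finrank_fintype_fun_eq_card, ← Nat.card_eq_fintype_card (α := P),
      Nat.card_coe_set_eq] at this
    simp at this
    omega
  obtain ⟨f, hf, a, ha⟩ := Fintype.not_linearIndependent_iff.1 hdep
  let p : MvPolynomial (Fin n) F := ∑ a, MvPolynomial.monomial (s a) (f a)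
  have hpa : p.coeff (s a) = f a := by
    simp only [p, MvPolynomial.coeff_sum, MvPolynomial.coeff_monomial]
    rw [Finset.sum_eq_single a] <;> simp +contextual [hs.eq_iff]
  have hp0 : p = 0 := by
    apply kak_zero hn p ?_ P hP
    · intro y hy
      have := congrFun hf ⟨y, hy⟩
      simp only [Finset.sum_apply, Pi.smul_apply, Pi.zero_apply, smul_eq_mul, M] at this
      simp only [p, map_sum, MvPolynomial.eval_monomial]
      rw [← this]
      refine Finset.sum_congr rfl fun b _ => ?_
      rw [Finsupp.prod_fintype _ _ (by simp)]
      rfl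
    · refine lt_of_le_of_lt ?_ hm
      refine MvPolynomial.totalDegree_finsetSum_le fun b _ => ?_
      refine (MvPolynomial.totalDegree_monomial_le _ _).trans ?_
      rw [Finsupp.sum_fintype _ _ (by simp)]
      calc ∑ i, s b i ≤ ∑ i : Fin n, m := Finset.sum_le_sum fun i _ => Nat.lt_succ_iff.1 (b i).2
        _ = n * m := by simp
  rw [hp0] at hpa
  exact ha (by simpa using hpa.symm)

/-- Besicovitch sets in `F^n` have cardinality at least
`c(n) · |F|^((n+2)/2)`. -/
theorem besicovitch_wolff_bound :
    ∀ n : ℕ, 2 ≤ n → ∃ c : ℝ, 0 < c ∧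
      ∀ (F : Type) [Field F] [Fintype F], 2 < ringChar F →
        ∀ P : Set (Fin n → F),
          (∀ v : Fin n → F, v ≠ 0 →
            ∃ x : Fin n → F, {y | ∃ t : F, y = x + t • v} ⊆ P) →
          c * (Fintype.card F : ℝ) ^ (((n : ℝ) + 2) / 2) ≤ (P.ncard : ℝ) := by
  intro n hn
  have hn0 : (0 : ℝ) < n := by exact_mod_cast (by omega : 0 < n)
  refine ⟨(1 / (n : ℝ)) ^ n, by positivity, ?_⟩
  intro F _ _ _ P hP
  have hq : 0 < Fintype.card F := Fintype.card_pos
  have hq1 : (1 : ℝ) ≤ Fintype.card F := by exact_mod_cast hq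
  have hb := kak_bound (by omega) P hP ((Fintype.card F - 1) / n) (by
    have := Nat.mul_div_le (Fintype.card F - 1) n
    omega)
  have hm : Fintype.card F ≤ n * ((Fintype.card F - 1) / n + 1) := by
    have := Nat.lt_mul_div_succ (Fintype.card F - 1) (by omega : 0 < n)
    omega
  have hm' : (Fintype.card F : ℝ) ≤ n * (((Fintype.card F - 1) / n + 1 : ℕ) : ℝ) := by
    exact_mod_cast hm
  have hpow : (Fintype.card F : ℝ) ^ (((n : ℝ) + 2) / 2) ≤ (Fintype.card F : ℝ) ^ n := by
    rw [← Real.rpow_natCast]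
    apply Real.rpow_le_rpow_of_exponent_le hq1
    have : (2 : ℝ) ≤ n := by exact_mod_cast hn
    linarith
  calc (1 / (n : ℝ)) ^ n * (Fintype.card F : ℝ) ^ (((n : ℝ) + 2) / 2)
      ≤ (1 / (n : ℝ)) ^ n * (Fintype.card F : ℝ) ^ n := by gcongr
    _ = (1 / (n : ℝ) * Fintype.card F) ^ n := by rw [mul_pow]
    _ ≤ ((((Fintype.card F - 1) / n + 1 : ℕ) : ℝ)) ^ n := by
      apply pow_le_pow_left₀ (by positivity)
      rw [one_div, inv_mul_le_iff₀ hn0]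
      exact hm'
    _ ≤ P.ncard := by exact_mod_cast hb
end

section
/- Let F be a finite field with char(F) > 2 and let ⟨,⟩ : F^4 × F^4 → F be a non-degenerate symmetric bilinear form. Let P := {x ∈ F^4 : ⟨x,x⟩ = 1} and let L be the set of all lines {x + t•v : t ∈ F} with x, v ∈ F^4, v ≠ 0, ⟨x,x⟩ = 1, ⟨v,x⟩ = 0 and ⟨v,v⟩ = 0. Then every line of L is contained in P, and there exist absolute constants c, C > 0 such that, provided |F| is sufficiently large, c·|F|^3 ≤ |P| ≤ C·|F|^3 and c·|F|^3 ≤ |L| ≤ C·|F|^3. -/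
open Set

/-- The "unit sphere" of a bilinear form `B` on `F^4`. -/
def quadricSphere (F : Type*) [Field F] (B : (Fin 4 → F) →ₗ[F] (Fin 4 → F) →ₗ[F] F) :
    Set (Fin 4 → F) :=
  {x | B x x = 1}

/-- The family of lines `{x + t • v}` with `⟨x,x⟩ = 1`, `⟨v,x⟩ = 0`, `⟨v,v⟩ = 0`. -/
def quadricLines (F : Type*) [Field F] (B : (Fin 4 → F) →ₗ[F] (Fin 4 → F) →ₗ[F] F) :
    Set (Set (Fin 4 → F)) :=
  {l | ∃ x v : Fin 4 → F, v ≠ 0 ∧ B x x = 1 ∧ B v x = 0 ∧ B v v = 0 ∧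
        l = {y | ∃ t : F, y = x + t • v}}


theorem qc_bin {F : Type} [Field F] [Fintype F] [DecidableEq F] (h2 : (2:F) ≠ 0) (a b d : F) (ha : a ≠ 0) (hb : b ≠ 0)
    (hd : d ≠ 0) : Fintype.card F ≤ (Finset.univ.filter (fun p : F × F => a * p.1^2 + b * p.2^2 = d)).card + 3 := by
  have hchar : ringChar F ≠ 2 := by
    intro h
    apply h2
    have := ringChar.Nat.cast_ringChar (R := F)
    rw [h] at this
    exact_mod_cast this
  obtain ⟨u, v, huv⟩ : ∃ u v : F, a * u^2 + b * v^2 = d := by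
    obtain ⟨u, v, h⟩ := FiniteField.exists_root_sum_quadratic (R := F)
      (f := Polynomial.C a * Polynomial.X^2) (g := Polynomial.C b * Polynomial.X^2 - Polynomial.C d)
      (by compute_degree!) (by compute_degree!)
      (FiniteField.odd_card_of_char_ne_two hchar)
    refine ⟨u, v, ?_⟩
    simp at h
    linear_combination h
  let p : Polynomial F := (Polynomial.C b * Polynomial.X^2 + Polynomial.C a) *
    (Polynomial.C (b*v) * Polynomial.X + Polynomial.C (a*u))
  have hp1 : (Polynomial.C b * Polynomial.X^2 + Polynomial.C a) ≠ 0 := by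
    intro h
    have := congrArg (fun r => Polynomial.eval 0 r) h
    simp at this
    exact ha this
  have hp2 : (Polynomial.C (b*v) * Polynomial.X + Polynomial.C (a*u)) ≠ 0 := by
    intro h
    have h0 := congrArg (fun r => Polynomial.eval 0 r) h
    have h1 := congrArg (fun r => Polynomial.eval 1 r) h
    simp at h0 h1
    have hu : u = 0 := by tauto
    have hv : v = 0 := by subst hu; simp at h1; tauto
    subst hu hv
    apply hd; rw [← huv]; ring
  have hp : p ≠ 0 := mul_ne_zero hp1 hp2
  have hdeg : p.natDegree ≤ 3 := by
    simp only [p]; compute_degree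
  have hroots : p.roots.toFinset.card ≤ 3 :=
    (Multiset.toFinset_card_le _).trans ((Polynomial.card_roots' p).trans hdeg)
  have hgood : ((Finset.univ : Finset F) \ p.roots.toFinset).card ≤ (Finset.univ.filter (fun p : F × F => a * p.1^2 + b * p.2^2 = d)).card := by
    have key : ∀ t ∈ ((Finset.univ : Finset F) \ p.roots.toFinset), b*t^2 + a ≠ 0 ∧ b*v*t+a*u ≠ 0 := by
      intro t ht
      simp [hp] at ht
      simp only [p] at ht
      simpa using ht
    apply Finset.card_le_card_of_injOn
      (fun t => (u - 2*(b*v*t+a*u)/(b*t^2+a), v - 2*(b*v*t+a*u)/(b*t^2+a)*t))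
    · intro t ht
      obtain ⟨h1, h3⟩ := key t ht
      simp
      rw [← huv]
      field_simp
      ring
    · intro t ht s hs hts
      obtain ⟨h1, h3⟩ := key t ht
      obtain ⟨h1', h3'⟩ := key s hs
      simp only [Prod.mk.injEq, sub_right_inj] at hts
      obtain ⟨e1, e2⟩ := hts
      rw [← e1] at e2
      exact mul_left_cancel₀ (div_ne_zero (mul_ne_zero h2 h3) h1) e2
  have := Finset.le_card_sdiff p.roots.toFinset (Finset.univ : Finset F)
  rw [Finset.card_univ] at this
  omega

theorem qc_two {F : Type} [Field F] [Fintype F] [DecidableEq F] (a d : F) (ha : a ≠ 0) :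
    (Finset.univ.filter (fun x : F => a * x^2 = d)).card ≤ 2 := by
  let p : Polynomial F := Polynomial.C a * Polynomial.X^2 - Polynomial.C d
  have hdeg : p.natDegree = 2 := by simp only [p]; compute_degree!
  have hp : p ≠ 0 := by intro h; rw [h] at hdeg; simp at hdeg
  have : (Finset.univ.filter (fun x : F => a * x^2 = d)) ⊆ p.roots.toFinset := by
    intro x hx
    simp at hx
    simp [hp]
    simp [p, hx]
  exact (Finset.card_le_card this).trans ((Multiset.toFinset_card_le _).trans ((Polynomial.card_roots' p).trans hdeg.le))

theorem qc_up {F : Type} [Field F] [Fintype F] [DecidableEq F] (n : ℕ) (w : Fin (n+1) → F) (hw : ∀ i, w i ≠ 0)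
    (d : F) : (Finset.univ.filter (fun x : Fin (n+1) → F => ∑ i, w i * x i ^ 2 = d)).card ≤ 2 * Fintype.card F ^ n := by
  have := Finset.card_le_mul_card_image_of_maps_to (s := (Finset.univ.filter (fun x : Fin (n+1) → F => ∑ i, w i * x i ^ 2 = d)))
    (t := (Finset.univ : Finset (Fin n → F))) (f := Fin.tail) (fun _ _ => Finset.mem_univ _) 2 ?_
  · simpa using this
  · intro y _
    refine le_trans ?_ (qc_two (w 0) (d - ∑ i : Fin n, w i.succ * y i ^ 2) (hw 0))
    apply Finset.card_le_card_of_injOn (fun x => x 0)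
    · intro x hx
      simp [Fin.sum_univ_succ] at hx ⊢
      rw [← hx.1, ← hx.2]
      simp [Fin.tail]
    · intro x hx x' hx' h
      simp at hx hx' h
      rw [← Fin.cons_self_tail x, ← Fin.cons_self_tail x', hx.2, hx'.2, h]

theorem qc_low {F : Type} [Field F] [Fintype F] [DecidableEq F] (h2 : (2:F) ≠ 0) (n : ℕ) (w : Fin (n+3) → F) (hw : ∀ i, w i ≠ 0)
    (d : F) (hq : 12 ≤ Fintype.card F) : Fintype.card F ^ (n+2) ≤ 2 * (Finset.univ.filter (fun x : Fin (n+3) → F => ∑ i, w i * x i ^ 2 = d)).card := by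
  set q := Fintype.card F
  have hup := qc_up n (fun i => w i.succ.succ) (fun i => hw _) d
  set G := (Finset.univ.filter (fun x : Fin (n+1) → F => ¬ ∑ i, w i.succ.succ * x i ^ 2 = d)) with hG
  have hGc : q^(n+1) ≤ G.card + 2 * q^n := by
    have := Finset.card_filter_add_card_filter_not (s := (Finset.univ : Finset (Fin (n+1) → F))) (fun x : Fin (n+1) → F => ∑ i, w i.succ.succ * x i ^ 2 = d)
    rw [Finset.card_univ] at this
    simp only [Fintype.card_fun, Fintype.card_fin] at this
    change Fintype.card F ^ (n+1) ≤ G.card + 2 * Fintype.card F ^ n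
    rw [hG]
    omega
  have hmul : (q - 3) * G.card ≤ (Finset.univ.filter (fun x : Fin (n+3) → F => ∑ i, w i * x i ^ 2 = d)).card := by
    have hbin : ∀ y ∈ G, q - 3 ≤ ((Finset.univ.filter (fun x : Fin (n+3) → F => ∑ i, w i * x i ^ 2 = d)).filter (fun x => Fin.tail (Fin.tail x) = y)).card := by
      intro y hy
      simp only [hG, Finset.mem_filter, Finset.mem_univ, true_and] at hy
      have h := qc_bin h2 (w 0) (w 1) (d - ∑ i, w i.succ.succ * y i ^ 2) (hw _) (hw _) (sub_ne_zero.2 (Ne.symm hy))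
      have h' : _ ≤ ((Finset.univ.filter (fun x : Fin (n+3) → F => ∑ i, w i * x i ^ 2 = d)).filter (fun x => Fin.tail (Fin.tail x) = y)).card :=
        Finset.card_le_card_of_injOn (s := Finset.univ.filter (fun p : F × F => w 0 * p.1^2 + w 1 * p.2^2 = d - ∑ i, w i.succ.succ * y i ^ 2))
        (fun p => (Fin.cons p.1 (Fin.cons p.2 y : Fin (n+2) → F) : Fin (n+3) → F)) (by
          intro p hp
          simp at hp
          simp [Fin.sum_univ_succ (n := n+2), Fin.sum_univ_succ (n := n+1)]
          linear_combination hp) (by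
          intro p hp p' hp' h
          have e0 := congrFun h 0
          have e1 := congrFun h 1
          have e1' : (Fin.cons p.1 (Fin.cons p.2 y : Fin (n+2) → F) : Fin (n+3) → F) (Fin.succ 0) = (Fin.cons p'.1 (Fin.cons p'.2 y : Fin (n+2) → F) : Fin (n+3) → F) (Fin.succ 0) := e1
          simp at e0 e1'
          exact Prod.ext e0 e1')
      omega
    have hc := Finset.card_nsmul_le_sum G _ (q-3) hbin
    rw [smul_eq_mul, mul_comm] at hc
    refine hc.trans ?_
    rw [← Finset.card_biUnion]
    · apply Finset.card_le_card
      intro x hx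
      simp at hx ⊢
      exact hx.2
    · intro y _ y' _ hne
      rw [Function.onFun, Finset.disjoint_left]
      intro x hx hx'
      simp at hx hx'
      exact hne (hx.2.symm.trans hx'.2)
  obtain ⟨r, hr⟩ : ∃ r, q = r + 12 := ⟨q - 12, by omega⟩
  have e1 : q^(n+1) = q^n * q := pow_succ _ _
  have e2 : q^(n+2) = q^n * q * q := by ring
  rw [e1] at hGc
  rw [e2]
  refine le_trans ?_ (Nat.mul_le_mul_left 2 hmul)
  generalize q^n = m at *
  have hr3 : q - 3 = r + 9 := by omega
  rw [hr3]
  rw [hr] at hGc ⊢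
  nlinarith [Nat.mul_le_mul_left (r+9) hGc, Nat.zero_le (m*r), Nat.zero_le (m*r*r)]

theorem qc_V {F : Type} [Field F] [Fintype F] (h2 : (2:F) ≠ 0) (hq : 12 ≤ Fintype.card F)
    (n : ℕ) (V : Type) [AddCommGroup V] [Module F V] [FiniteDimensional F V]
    (hV : Module.finrank F V = n + 3) (B : V →ₗ[F] V →ₗ[F] F) (hs : ∀ x y, B x y = B y x)
    (hn : ∀ x, (∀ y, B x y = 0) → x = 0) (d : F) :
    Fintype.card F ^ (n+2) ≤ 2 * Nat.card {v : V // B v v = d} ∧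
    Nat.card {v : V // B v v = d} ≤ 2 * Fintype.card F ^ (n+2) := by
  classical
  have : Invertible (2:F) := invertibleOfNonzero h2
  have hex := QuadraticForm.equivalent_weightedSumSquares_units_of_nondegenerate'
    (LinearMap.BilinMap.toQuadraticMap B) (by
      rw [QuadraticMap.associated_left_inverse F hs]
      exact hn)
  rw [hV] at hex
  obtain ⟨w, ⟨e⟩⟩ := hex
  have hc : Nat.card {v : V // B v v = d} = (Finset.univ.filter (fun x : Fin (n+3) → F => ∑ i, (w i : F) * x i ^ 2 = d)).card := by
    rw [← Fintype.card_subtype, ← Nat.card_eq_fintype_card]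
    apply Nat.card_congr
    refine e.toLinearEquiv.toEquiv.subtypeEquiv ?_
    intro v
    have := e.map_app v
    rw [QuadraticMap.weightedSumSquares_apply] at this
    simp only [LinearMap.BilinMap.toQuadraticMap_apply] at this
    rw [← this]
    simp [Units.smul_def, sq]
  rw [hc]
  exact ⟨qc_low h2 n _ (fun i => (w i).ne_zero) d hq, qc_up (n+2) _ (fun i => (w i).ne_zero) d⟩

theorem qc_perp {F : Type} [Field F] [Fintype F] (h2 : (2:F) ≠ 0) (hq : 12 ≤ Fintype.card F)
    (B : (Fin 4 → F) →ₗ[F] (Fin 4 → F) →ₗ[F] F) (hs : ∀ x y, B x y = B y x)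
    (hn : ∀ x, (∀ y, B x y = 0) → x = 0) (x : Fin 4 → F) (hx : B x x = 1) :
    Fintype.card F ^ 2 ≤ 4 * Nat.card {v : Fin 4 → F // v ≠ 0 ∧ B v x = 0 ∧ B v v = 0} ∧
    Nat.card {v : Fin 4 → F // v ≠ 0 ∧ B v x = 0 ∧ B v v = 0} ≤ 2 * Fintype.card F ^ 2 := by
  classical
  have hne : B x ≠ 0 := by intro h; rw [h] at hx; simp at hx
  have hfr := Module.Dual.finrank_ker_add_one_of_ne_zero (f := B x) hne
  rw [Module.finrank_fin_fun] at hfr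
  have := qc_V h2 hq 0 (LinearMap.ker (B x)) (by omega)
    ((B.domRestrict (LinearMap.ker (B x))).compl₂ (LinearMap.ker (B x)).subtype)
    (fun a b => by simpa using hs a b) (by
      rintro ⟨a, ha⟩ h
      rw [LinearMap.mem_ker] at ha
      ext1
      apply hn
      intro y
      have h1 := h ⟨y - B x y • x, by simp [hx]⟩
      simp at h1
      rw [hs a x, ha] at h1
      simpa using h1) 0
  have hc : Nat.card {v : LinearMap.ker (B x) // ((B.domRestrict (LinearMap.ker (B x))).compl₂ (LinearMap.ker (B x)).subtype) v v = 0} = Nat.card {v : Fin 4 → F // v ≠ 0 ∧ B v x = 0 ∧ B v v = 0} + 1 := by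
    have e1 : Nat.card {v : LinearMap.ker (B x) // ((B.domRestrict (LinearMap.ker (B x))).compl₂ (LinearMap.ker (B x)).subtype) v v = 0} = ({v : Fin 4 → F | B v x = 0 ∧ B v v = 0}).ncard := by
      rw [← Nat.card_coe_set_eq]
      apply Nat.card_congr
      exact
        { toFun := fun v => ⟨v.1.1, by
            have h1 := v.1.2
            have h3 := v.2
            rw [LinearMap.mem_ker, hs] at h1
            exact ⟨h1, by simpa using h3⟩⟩
          invFun := fun v => ⟨⟨v.1, by rw [LinearMap.mem_ker, hs]; exact v.2.1⟩, by simpa using v.2.2⟩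
          left_inv := fun v => rfl
          right_inv := fun v => rfl }
    have e2 : Nat.card {v : Fin 4 → F // v ≠ 0 ∧ B v x = 0 ∧ B v v = 0} = ({v : Fin 4 → F | B v x = 0 ∧ B v v = 0} \ {0}).ncard := by
      rw [← Nat.card_coe_set_eq]
      apply Nat.card_congr
      apply Equiv.subtypeEquivRight
      intro v
      simp [and_comm]
    rw [e1, e2, Set.ncard_sdiff_singleton_add_one]
    simp
  rw [hc] at this
  simp only [zero_add] at this
  constructor
  · nlinarith [this.1]
  · omega

theorem qc_fib {F : Type} [Field F] [Fintype F] [DecidableEq F]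
    (B : (Fin 4 → F) →ₗ[F] (Fin 4 → F) →ₗ[F] F) (hs : ∀ x y, B x y = B y x)
    (P : Finset ((Fin 4 → F) × (Fin 4 → F)))
    (hP : ∀ p, p ∈ P ↔ p.2 ≠ 0 ∧ B p.1 p.1 = 1 ∧ B p.2 p.1 = 0 ∧ B p.2 p.2 = 0)
    (f : ((Fin 4 → F) × (Fin 4 → F)) → Set (Fin 4 → F))
    (hf : ∀ p, f p = {y | ∃ t : F, y = p.1 + t • p.2}) [DecidableEq (Set (Fin 4 → F))]
    (p : (Fin 4 → F) × (Fin 4 → F)) (hp : p ∈ P) :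
    (P.filter (fun r => f r = f p)).card ≤ Fintype.card F ^ 2 ∧
    Fintype.card F * (Fintype.card F - 1) ≤ (P.filter (fun r => f r = f p)).card := by
  have hp' := (hP p).1 hp
  obtain ⟨x, v⟩ := p
  obtain ⟨h0, h1, h3, h4⟩ := hp'
  simp only at h0 h1 h3 h4
  have h3' : B x v = 0 := by rw [hs, h3]
  have himg : P.filter (fun r => f r = f (x,v)) ⊆
      (Finset.univ : Finset (F × F)).image (fun s => (x + s.1 • v, s.2 • v)) := by
    intro ⟨x', v'⟩ hr
    simp only [Finset.mem_filter, hf] at hr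
    obtain ⟨_, hr⟩ := hr
    have m1 : x' ∈ {y | ∃ t : F, y = x + t • v} := by rw [← hr]; exact ⟨0, by simp⟩
    have m2 : x' + v' ∈ {y | ∃ t : F, y = x + t • v} := by rw [← hr]; exact ⟨1, by simp⟩
    obtain ⟨s, hs1⟩ := m1
    obtain ⟨t, ht⟩ := m2
    simp only [Finset.mem_image, Finset.mem_univ, true_and]
    refine ⟨(s, t - s), ?_⟩
    simp only [Prod.mk.injEq]
    refine ⟨hs1.symm, ?_⟩
    rw [sub_smul]
    rw [hs1] at ht
    have : v' = (x + s • v + v') - (x + s • v) := by abel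
    rw [this, ht]; abel
  constructor
  · refine (Finset.card_le_card himg).trans (Finset.card_image_le.trans ?_)
    simp [sq]
  · have : Fintype.card F * (Fintype.card F - 1) = (Finset.univ ×ˢ (Finset.univ.erase 0) : Finset (F × F)).card := by
      simp [Finset.card_product]
    rw [this]
    apply Finset.card_le_card_of_injOn (fun s => (x + s.1 • v, s.2 • v))
    · rintro ⟨s, t⟩ hst
      simp at hst
      simp only [Finset.coe_filter, Set.mem_ofPred_eq, hP, hf]
      refine ⟨⟨smul_ne_zero hst h0, ?_, ?_, ?_⟩, ?_⟩
      · simp [h1, h3, h3', h4]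
      · simp [h3, h4]
      · simp [h4]
      · ext y
        constructor
        · rintro ⟨r, rfl⟩
          exact ⟨s + r * t, by simp only [smul_smul, add_smul]; abel⟩
        · rintro ⟨r, rfl⟩
          refine ⟨(r - s) / t, ?_⟩
          simp only [smul_smul]
          rw [div_mul_cancel₀ _ hst, sub_smul]; abel
    · rintro ⟨s, t⟩ _ ⟨s', t'⟩ _ h
      simp only [Prod.mk.injEq, add_right_inj] at h
      exact Prod.ext (smul_left_injective F h0 h.1) (smul_left_injective F h0 h.2)

/-- the quadric counterexample: every line of `L` lies in `P`, and for
`|F|` large both `P` and `L` have cardinality comparable to `|F|^3`. -/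
theorem quadric_counterexample :
    ∃ c C : ℝ, 0 < c ∧ 0 < C ∧ ∃ N : ℕ,
      ∀ (F : Type) [Field F] [Fintype F], 2 < ringChar F →
        ∀ B : (Fin 4 → F) →ₗ[F] (Fin 4 → F) →ₗ[F] F,
          (∀ x y : Fin 4 → F, B x y = B y x) →
          (∀ x : Fin 4 → F, (∀ y : Fin 4 → F, B x y = 0) → x = 0) →
          (∀ l ∈ quadricLines F B, l ⊆ quadricSphere F B) ∧
          (N ≤ Fintype.card F →
            c * (Fintype.card F : ℝ) ^ 3 ≤ ((quadricSphere F B).ncard : ℝ) ∧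
            ((quadricSphere F B).ncard : ℝ) ≤ C * (Fintype.card F : ℝ) ^ 3 ∧
            c * (Fintype.card F : ℝ) ^ 3 ≤ ((quadricLines F B).ncard : ℝ) ∧
            ((quadricLines F B).ncard : ℝ) ≤ C * (Fintype.card F : ℝ) ^ 3) := by
  refine ⟨1/8, 8, by norm_num, by norm_num, 12, ?_⟩
  intro F _ _ hchar B hs hn
  classical
  have h2 : (2:F) ≠ 0 := Ring.two_ne_zero (by omega)
  constructor
  · rintro l ⟨x, v, h0, h1, h3, h4, rfl⟩ y ⟨t, rfl⟩
    have h3' : B x v = 0 := by rw [hs, h3]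
    simp [quadricSphere, h1, h3, h3', h4]
  intro hq
  have hS := qc_V h2 hq 1 (Fin 4 → F) (by simp) B hs hn 1
  have hSc : Nat.card {v : Fin 4 → F // B v v = 1} = (quadricSphere F B).ncard := by
    rw [← Nat.card_coe_set_eq]; rfl
  rw [hSc] at hS
  set q := Fintype.card F with hqdef
  set S := (quadricSphere F B).ncard with hSdef
  let P : Finset ((Fin 4 → F) × (Fin 4 → F)) :=
    Finset.univ.filter (fun p => p.2 ≠ 0 ∧ B p.1 p.1 = 1 ∧ B p.2 p.1 = 0 ∧ B p.2 p.2 = 0)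
  have hP : ∀ p, p ∈ P ↔ p.2 ≠ 0 ∧ B p.1 p.1 = 1 ∧ B p.2 p.1 = 0 ∧ B p.2 p.2 = 0 := by
    intro p; simp [P]
  let f : ((Fin 4 → F) × (Fin 4 → F)) → Set (Fin 4 → F) := fun p => {y | ∃ t : F, y = p.1 + t • p.2}
  have hfib := qc_fib B hs P hP f (fun _ => rfl)
  have hL : quadricLines F B = ((P.image f : Finset _) : Set (Set (Fin 4 → F))) := by
    ext l
    simp only [quadricLines, Set.mem_ofPred_eq, Finset.coe_image, Set.mem_image, Finset.mem_coe, hP, Prod.exists, f]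
    constructor
    · rintro ⟨x, v, a, b, c, d, rfl⟩
      exact ⟨x, v, ⟨a, b, c, d⟩, rfl⟩
    · rintro ⟨x, v, ⟨a, b, c, d⟩, rfl⟩
      exact ⟨x, v, a, b, c, d, rfl⟩
  have hLc : (quadricLines F B).ncard = (P.image f).card := by
    rw [hL, Set.ncard_coe_finset]
  rw [hLc]
  have hPL1 : P.card ≤ q^2 * (P.image f).card := by
    apply Finset.card_le_mul_card_image_of_maps_to (f := f) (fun a ha => Finset.mem_image_of_mem f ha)
    intro l hl
    obtain ⟨p, hp, rfl⟩ := Finset.mem_image.1 hl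
    exact (hfib p hp).1
  have hPL2 : q * (q-1) * (P.image f).card ≤ P.card := by
    apply Finset.mul_card_image_le_card_of_maps_to (f := f) (fun a ha => Finset.mem_image_of_mem f ha)
    intro l hl
    obtain ⟨p, hp, rfl⟩ := Finset.mem_image.1 hl
    exact (hfib p hp).2
  let T : Finset (Fin 4 → F) := Finset.univ.filter (fun x => B x x = 1)
  have hT : S = T.card := by
    rw [hSdef, ← Set.ncard_coe_finset]; congr 1; ext x; simp [T, quadricSphere]
  have hfx : ∀ x ∈ T, (P.filter (fun p => p.1 = x)).card = Nat.card {v : Fin 4 → F // v ≠ 0 ∧ B v x = 0 ∧ B v v = 0} := by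
    intro x hx
    have hx' : B x x = 1 := by simpa [T] using hx
    rw [Nat.card_eq_fintype_card, Fintype.card_subtype]
    symm
    apply Finset.card_bij (fun v _ => (x, v))
    · intro v hv
      simp at hv
      simp [hP, hx', hv]
    · intro v _ v' _ h
      simpa using h
    · rintro ⟨x', v⟩ hv
      simp only [Finset.mem_filter, hP] at hv
      obtain ⟨⟨a, b, c, d⟩, rfl⟩ := hv
      exact ⟨v, by simp; exact ⟨a, c, d⟩, rfl⟩
  have hmaps : ∀ p ∈ P, p.1 ∈ T := by
    intro p hp
    simp [T, ((hP p).1 hp).2.1]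
  have hsum := Finset.card_eq_sum_card_fiberwise (s := P) (f := Prod.fst) (t := T) hmaps
  have hU : P.card ≤ 2 * q^2 * T.card := by
    apply Finset.card_le_mul_card_image_of_maps_to hmaps
    intro x hx
    rw [hfx x hx]
    exact (qc_perp h2 hq B hs hn x (by simpa [T] using hx)).2
  have hLo : q^2 * T.card ≤ 4 * P.card := by
    rw [hsum, Finset.mul_sum, mul_comm, ← smul_eq_mul]
    apply Finset.card_nsmul_le_sum
    intro x hx
    rw [hfx x hx]
    exact (qc_perp h2 hq B hs hn x (by simpa [T] using hx)).1
  rw [← hT] at hU hLo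
  norm_num at hS
  obtain ⟨hS1, hS2⟩ := hS
  set L := (P.image f).card
  have hq0 : 0 < q := by omega
  have hqq : 0 < q^2 := by positivity
  have r1 : q^3 ≤ 8 * L := by
    have : q^2 * S ≤ q^2 * (4 * L) := by nlinarith
    have := Nat.le_of_mul_le_mul_left this hqq
    omega
  have r2 : L ≤ 8 * q^3 := by
    have h5 : q * q ≤ 2 * (q * (q - 1)) := by
      obtain ⟨r, hr⟩ : ∃ r, q = r + 12 := ⟨q - 12, by omega⟩
      have : q - 1 = r + 11 := by omega
      rw [this, hr]; nlinarith
    have h6 : q^2 * L ≤ q^2 * (4 * S) := by nlinarith [Nat.mul_le_mul_right L h5]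
    have := Nat.le_of_mul_le_mul_left h6 hqq
    omega
  have c1 : (q:ℝ)^3 ≤ 2 * S := by exact_mod_cast hS1
  have c2 : (S:ℝ) ≤ 2 * q^3 := by exact_mod_cast hS2
  have c3 : (q:ℝ)^3 ≤ 8 * L := by exact_mod_cast r1
  have c4 : (L:ℝ) ≤ 8 * q^3 := by exact_mod_cast r2
  have c5 : (0:ℝ) ≤ (q:ℝ)^3 := by positivity
  refine ⟨?_, ?_, ?_, ?_⟩ <;> linarith
end

section
/- Let F be a finite field with char(F) > 2 and let ⟨,⟩ : F^4 × F^4 → F be a non-degenerate symmetric bilinear form. Let L be the set of all lines {x + t•v : t ∈ F} with x, v ∈ F^4, v ≠ 0, ⟨x,x⟩ = 1, ⟨v,x⟩ = 0 and ⟨v,v⟩ = 0. Then there is an absolute constant C such that every 3-dimensional affine subspace λ ⊆ F^4 contains at most C·|F| lines of L; in particular L obeys the Wolff axiom. -/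
open Set

/-- Orthogonal subspaces have complementary dimension at most. -/
lemma aux_orth {F : Type} [Field F] (B : (Fin 4 → F) →ₗ[F] (Fin 4 → F) →ₗ[F] F)
    (hs : ∀ x y : Fin 4 → F, B x y = B y x)
    (hn : ∀ x : Fin 4 → F, (∀ y : Fin 4 → F, B x y = 0) → x = 0)
    (U : Submodule F (Fin 4 → F)) :
    Module.finrank F (LinearMap.BilinForm.orthogonal B U) = 4 - Module.finrank F U := by
  have hnd : LinearMap.BilinForm.Nondegenerate B := by
    refine ⟨fun x hx => hn x hx, fun x hx => hn x fun y => ?_⟩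
    rw [hs]; exact hx y
  have := LinearMap.BilinForm.finrank_orthogonal hnd U
  simpa using this

lemma aux_orth_span {F : Type} [Field F] (B : (Fin 4 → F) →ₗ[F] (Fin 4 → F) →ₗ[F] F)
    (hs : ∀ x y : Fin 4 → F, B x y = B y x)
    (hn : ∀ x : Fin 4 → F, (∀ y : Fin 4 → F, B x y = 0) → x = 0)
    {k m : ℕ} (a : Fin k → Fin 4 → F) (b : Fin m → Fin 4 → F)
    (ha : LinearIndependent F a) (hb : LinearIndependent F b)
    (hab : ∀ i j, B (a i) (b j) = 0) : k + m ≤ 4 := by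
  have h1 := aux_orth B hs hn (Submodule.span F (Set.range a))
  have h2 : Submodule.span F (Set.range b) ≤
      LinearMap.BilinForm.orthogonal B (Submodule.span F (Set.range a)) := by
    rw [Submodule.span_le]
    rintro _ ⟨j, rfl⟩
    rw [SetLike.mem_coe, LinearMap.BilinForm.mem_orthogonal_iff]
    intro x hx
    show B x (b j) = 0
    induction hx using Submodule.span_induction with
    | mem x h => obtain ⟨i, rfl⟩ := h; exact hab i j
    | zero => simp
    | add x y _ _ hx hy => simp [hx, hy]
    | smul c x _ hx => simp [hx]
  have h3 := Submodule.finrank_mono h2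
  rw [finrank_span_eq_card hb, h1, finrank_span_eq_card ha] at h3
  have h4 := Submodule.finrank_le (Submodule.span F (Set.range a))
  rw [finrank_span_eq_card ha] at h4
  simp at h3 h4
  omega

/-- Two non-parallel null directions at a point of the sphere are not orthogonal. -/
lemma aux_A {F : Type} [Field F] (B : (Fin 4 → F) →ₗ[F] (Fin 4 → F) →ₗ[F] F)
    (hs : ∀ x y : Fin 4 → F, B x y = B y x)
    (hn : ∀ x : Fin 4 → F, (∀ y : Fin 4 → F, B x y = 0) → x = 0)
    (v w y : Fin 4 → F) (hvw : LinearIndependent F ![v, w])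
    (hv : B v v = 0) (hw : B w w = 0) (hvy : B v y = 0) (hwy : B w y = 0)
    (hy : B y y = 1) : B v w ≠ 0 := by
  intro h
  have h' : B w v = 0 := by rw [hs]; exact h
  have hi : LinearIndependent F ![y, v, w] := by
    refine linearIndependent_finCons.2 ?_
    refine ⟨hvw, fun hm => ?_⟩
    have : y ∈ Submodule.span F {v, w} := by simpa [Set.pair_comm] using hm
    obtain ⟨a, b, hab⟩ := Submodule.mem_span_pair.1 this
    have : B (a • v + b • w) y = 0 := by simp [hvy, hwy]
    rw [hab, hy] at this
    exact one_ne_zero this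
  have := aux_orth_span B hs hn _ _ hvw hi (by
    clear hs hn
    intro i j
    fin_cases i <;> fin_cases j <;> simp [*])
  omega

/-- Among three null directions at `y` inside the hyperplane, two are parallel. -/
lemma aux_three {F : Type} [Field F] (h2 : (2 : F) ≠ 0)
    (B : (Fin 4 → F) →ₗ[F] (Fin 4 → F) →ₗ[F] F)
    (hs : ∀ x y : Fin 4 → F, B x y = B y x)
    (hn : ∀ x : Fin 4 → F, (∀ y : Fin 4 → F, B x y = 0) → x = 0)
    (n y u v w : Fin 4 → F) (hny : LinearIndependent F ![n, y])
    (hy : B y y = 1) (hw0 : w ≠ 0)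
    (huu : B u u = 0) (hvv : B v v = 0) (hww : B w w = 0)
    (huy : B u y = 0) (hvy : B v y = 0) (hwy : B w y = 0)
    (hun : B u n = 0) (hvn : B v n = 0) (hwn : B w n = 0)
    (huv : LinearIndependent F ![u, v]) :
    (∃ a : F, a ≠ 0 ∧ w = a • u) ∨ (∃ a : F, a ≠ 0 ∧ w = a • v) := by
  have hA := aux_A B hs hn u v y huv huu hvv huy hvy hy
  have hd : ¬ LinearIndependent F ![w, u, v] := by
    intro hi
    have := aux_orth_span B hs hn _ _ hi hny (by
      clear hs hn
      intro i j
      fin_cases i <;> fin_cases j <;> simp [*])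
    omega
  have hm : w ∈ Submodule.span F {u, v} := by
    by_contra hc
    exact hd (linearIndependent_finCons.2 ⟨huv, by simpa [Set.pair_comm] using hc⟩)
  obtain ⟨a, b, rfl⟩ := Submodule.mem_span_pair.1 hm
  have : 2 * (a * b * B u v) = 0 := by
    rw [← hww]
    simp only [map_add, map_smul, LinearMap.add_apply, LinearMap.smul_apply, huu, hvv, hs v u,
      smul_eq_mul]
    ring
  have hab : a = 0 ∨ b = 0 := by
    simpa [h2, hA] using this
  rcases hab with rfl | rfl
  · right
    refine ⟨b, ?_, by simp⟩
    rintro rfl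
    simp at hw0
  · left
    refine ⟨a, ?_, by simp⟩
    rintro rfl
    simp at hw0

lemma aux_line_eq {F : Type} [Field F] (y u w : Fin 4 → F) (a : F) (ha : a ≠ 0)
    (h : w = a • u) : {z | ∃ t : F, z = y + t • w} = {z | ∃ t : F, z = y + t • u} := by
  subst h
  ext z
  constructor
  · rintro ⟨t, rfl⟩
    exact ⟨t * a, by rw [smul_smul]⟩
  · rintro ⟨t, rfl⟩
    exact ⟨t * a⁻¹, by rw [smul_smul, mul_assoc, inv_mul_cancel₀ ha, mul_one]⟩

/-- Rebase a line of the family at any of its points. -/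
lemma aux_rebase {F : Type} [Field F] (B : (Fin 4 → F) →ₗ[F] (Fin 4 → F) →ₗ[F] F)
    (hs : ∀ x y : Fin 4 → F, B x y = B y x)
    (l : Set (Fin 4 → F)) (hl : l ∈ quadricLines F B) (y : Fin 4 → F) (hy : y ∈ l) :
    B y y = 1 ∧ ∃ v, v ≠ 0 ∧ B v y = 0 ∧ B v v = 0 ∧ l = {z | ∃ t : F, z = y + t • v} := by
  obtain ⟨x, v, hv, hx, hvx, hvv, rfl⟩ := hl
  obtain ⟨t, rfl⟩ := hy
  refine ⟨?_, v, hv, ?_, hvv, ?_⟩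
  · simp [hx, hvx, hvv, hs x v]
  · simp [hvx, hvv]
  · ext z
    constructor
    · rintro ⟨s, rfl⟩
      exact ⟨s - t, by module⟩
    · rintro ⟨s, rfl⟩
      exact ⟨s + t, by module⟩

/-- The sphere has at most `2 q^2` points in the hyperplane. -/
lemma aux_sphere {F : Type} [Field F] [Fintype F] (h2 : (2 : F) ≠ 0)
    (B : (Fin 4 → F) →ₗ[F] (Fin 4 → F) →ₗ[F] F)
    (hs : ∀ x y : Fin 4 → F, B x y = B y x)
    (W : Submodule F (Fin 4 → F)) (p w : Fin 4 → F) (hW : Module.finrank F W = 3)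
    (hw : w ∈ W) (hww : B w w ≠ 0) (S : Finset (Fin 4 → F))
    (hS : ∀ x ∈ S, B x x = 1 ∧ x - p ∈ W) :
    S.card ≤ 2 * Fintype.card F ^ 2 := by
  classical
  let T : Finset (Fin 4 → F) := Finset.univ.filter fun x => x - p ∈ W
  have hT : T.card = Fintype.card F ^ 3 := by
    have h1 : T = (Finset.univ.filter fun x => x ∈ W).image (fun x => x + p) := by
      ext x
      simp only [T, Finset.mem_filter, Finset.mem_univ, true_and, Finset.mem_image]
      constructor
      · intro h; exact ⟨x - p, h, by simp⟩
      · rintro ⟨z, hz, rfl⟩; simpa using hz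
    rw [h1, Finset.card_image_of_injective _ (add_left_injective p), ← hW,
      ← Module.card_eq_pow_finrank (K := F) (V := W), Fintype.card_subtype]
  have hw0 : w ≠ 0 := by rintro rfl; simp at hww
  have key := Finset.card_mul_le_card_mul (s := S) (t := T) (fun x y => ∃ t : F, y = x + t • w)
    (m := Fintype.card F) (n := 2) (by
      intro x hx
      have : (Finset.univ.image fun t : F => x + t • w) ⊆
          T.bipartiteAbove (fun x y => ∃ t : F, y = x + t • w) x := by
        intro y hy
        obtain ⟨t, -, rfl⟩ := Finset.mem_image.1 hy
        rw [Finset.mem_bipartiteAbove]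
        refine ⟨?_, t, rfl⟩
        simp only [T, Finset.mem_filter, Finset.mem_univ, true_and]
        have := W.add_mem (hS x hx).2 (W.smul_mem t hw)
        convert this using 1
        abel
      refine le_trans (le_of_eq ?_) (Finset.card_le_card this)
      rw [Finset.card_image_of_injective, Finset.card_univ]
      intro s t hst
      exact smul_left_injective F hw0 (add_left_cancel hst)) (by
      intro y hy
      by_contra hc
      rw [not_le, Finset.two_lt_card] at hc
      obtain ⟨a, ha, b, hb, c, hc, hab, hac, hbc⟩ := hc
      rw [Finset.mem_bipartiteBelow] at ha hb hc
      obtain ⟨haS, r, har⟩ := ha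
      obtain ⟨hbS, s, hbs⟩ := hb
      obtain ⟨hcS, t, hct⟩ := hc
      have ea : a = y - r • w := by rw [har]; simp
      have eb : b = y - s • w := by rw [hbs]; simp
      have ec : c = y - t • w := by rw [hct]; simp
      have h1 := (hS a haS).1
      have h2 := (hS b hbS).1
      have h3 := (hS c hcS).1
      subst ea eb ec
      simp only [map_sub, map_smul, LinearMap.sub_apply, LinearMap.smul_apply, smul_eq_mul,
        hs w y] at h1 h2 h3
      have hrs : r - s ≠ 0 := fun h => hab (by rw [sub_eq_zero.1 h])
      have hrt : r - t ≠ 0 := fun h => hac (by rw [sub_eq_zero.1 h])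
      have hst : s - t ≠ 0 := fun h => hbc (by rw [sub_eq_zero.1 h])
      have e1 : (r - s) * ((r + s) * B w w - 2 * B y w) = 0 := by linear_combination h1 - h2
      have e2 : (r - t) * ((r + t) * B w w - 2 * B y w) = 0 := by linear_combination h1 - h3
      have e1' := (mul_eq_zero.1 e1).resolve_left hrs
      have e2' := (mul_eq_zero.1 e2).resolve_left hrt
      have e3 : (s - t) * B w w = 0 := by linear_combination e1' - e2'
      exact (mul_ne_zero hst hww) e3)
  rw [hT] at key
  have hq : 0 < Fintype.card F := Fintype.card_pos
  refine Nat.le_of_mul_le_mul_right (c := Fintype.card F) ?_ hq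
  calc _ ≤ _ := key
    _ = _ := by ring

lemma aux_main {F : Type} [Field F] [Fintype F] (h2 : (2 : F) ≠ 0)
    (B : (Fin 4 → F) →ₗ[F] (Fin 4 → F) →ₗ[F] F)
    (hs : ∀ x y : Fin 4 → F, B x y = B y x)
    (hn : ∀ x : Fin 4 → F, (∀ y : Fin 4 → F, B x y = 0) → x = 0)
    (W : Submodule F (Fin 4 → F)) (p : Fin 4 → F) (hW : Module.finrank F W = 3)
    (L : Finset (Set (Fin 4 → F)))
    (hL : ∀ l ∈ L, l ∈ quadricLines F B ∧ ∀ y ∈ l, y - p ∈ W) :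
    L.card ≤ 8 * Fintype.card F := by
  classical
  -- a normal vector
  have hWo := aux_orth B hs hn W
  rw [hW] at hWo
  obtain ⟨n, hn0, hnW⟩ : ∃ n : Fin 4 → F, n ≠ 0 ∧ ∀ v ∈ W, B v n = 0 := by
    have : LinearMap.BilinForm.orthogonal B W ≠ ⊥ := by
      intro h
      rw [h] at hWo
      simp at hWo
    obtain ⟨n, hn1, hn2⟩ := Submodule.exists_mem_ne_zero_of_ne_bot this
    exact ⟨n, hn2, fun v hv => (LinearMap.BilinForm.mem_orthogonal_iff.1 hn1) v hv⟩
  -- a non-isotropic vector in `W`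
  obtain ⟨w, hw, hww⟩ : ∃ w ∈ W, B w w ≠ 0 := by
    by_contra! hc
    have hle : W ≤ LinearMap.BilinForm.orthogonal B W := by
      intro y hy
      rw [LinearMap.BilinForm.mem_orthogonal_iff]
      intro x hx
      show B x y = 0
      have h1 := hc _ (W.add_mem hx hy)
      simp only [map_add, LinearMap.add_apply, hc x hx, hc y hy, hs y x] at h1
      have h3 : 2 * B x y = 0 := by linear_combination h1
      exact (mul_eq_zero.1 h3).resolve_left h2
    have := Submodule.finrank_mono hle
    omega
  let S : Finset (Fin 4 → F) := Finset.univ.filter fun x =>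
    (B x x = 1 ∧ x - p ∈ W) ∧ LinearIndependent F ![n, x]
  have hS : S.card ≤ 2 * Fintype.card F ^ 2 :=
    aux_sphere h2 B hs W p w hW hw hww S (by
      intro x hx
      exact (Finset.mem_filter.1 hx).2.1)
  -- direction of a line lies in `W`
  have hdir : ∀ y v : Fin 4 → F, (∀ z ∈ {z | ∃ t : F, z = y + t • v}, z - p ∈ W) → v ∈ W := by
    intro y v h
    have h0 := h y ⟨0, by simp⟩
    have h1 := h (y + v) ⟨1, by simp⟩
    have := W.sub_mem h1 h0
    convert this using 1
    abel
  have key := Finset.card_mul_le_card_mul (s := L) (t := S) (fun l y => y ∈ l)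
    (m := Fintype.card F - 1) (n := 2) (by
      intro l hl
      obtain ⟨hlq, hlW⟩ := hL l hl
      obtain ⟨x, v, hv, hx, hvx, hvv, hleq⟩ := id hlq
      -- at most one bad parameter
      have hbad : ∀ s t : F, (¬ LinearIndependent F ![n, x + s • v]) →
          (¬ LinearIndependent F ![n, x + t • v]) → s = t := by
        intro s t h1 h2
        by_contra hst
        rw [LinearIndependent.pair_iff' hn0] at h1 h2
        push Not at h1 h2
        obtain ⟨a, ha⟩ := h1
        obtain ⟨b, hb⟩ := h2
        have hst' : s - t ≠ 0 := sub_ne_zero.2 hst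
        have hv' : (s - t) • v = (a - b) • n := by
          rw [sub_smul a b, ha, hb]; module
        have hab : a - b ≠ 0 := by
          intro h
          rw [h, zero_smul, smul_eq_zero] at hv'
          exact hv'.elim hst' hv
        have hn' : n = ((a - b)⁻¹ * (s - t)) • v := by
          rw [mul_smul, hv', smul_smul, inv_mul_cancel₀ hab, one_smul]
        have hx' : x = (a * ((a - b)⁻¹ * (s - t)) - s) • v := by
          rw [sub_smul, mul_smul, ← hn', ha]; simp
        rw [hx'] at hx
        simp [hvv] at hx
      let G : Finset F := Finset.univ.filter fun t => LinearIndependent F ![n, x + t • v]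
      have hG : Fintype.card F - 1 ≤ G.card := by
        have h1 := Finset.card_filter_add_card_filter_not (s := (Finset.univ : Finset F))
          (fun t => LinearIndependent F ![n, x + t • v])
        have h3 : (Finset.univ.filter fun t : F =>
            ¬ LinearIndependent F ![n, x + t • v]).card ≤ 1 := by
          rw [Finset.card_le_one]
          intro s hs t ht
          exact hbad s t (Finset.mem_filter.1 hs).2 (Finset.mem_filter.1 ht).2
        rw [Finset.card_univ] at h1
        show _ ≤ (Finset.univ.filter fun t => LinearIndependent F ![n, x + t • v]).card
        omega
      refine hG.trans ?_
      have hinj : Function.Injective fun t : F => x + t • v := by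
        intro s t hst
        exact smul_left_injective F hv (add_left_cancel hst)
      rw [← Finset.card_image_of_injective G hinj]
      apply Finset.card_le_card
      intro y hy
      obtain ⟨t, ht, rfl⟩ := Finset.mem_image.1 hy
      have hyl : x + t • v ∈ l := by rw [hleq]; exact ⟨t, rfl⟩
      rw [Finset.mem_bipartiteAbove]
      refine ⟨Finset.mem_filter.2 ⟨Finset.mem_univ _, ⟨?_, hlW _ hyl⟩,
        (Finset.mem_filter.1 ht).2⟩, hyl⟩
      exact (aux_rebase B hs l hlq _ hyl).1) (by
      intro y hy
      obtain ⟨-, ⟨hyy, hyW⟩, hny⟩ := Finset.mem_filter.1 hy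
      by_contra hc
      rw [not_le, Finset.two_lt_card] at hc
      obtain ⟨a, ha, b, hb, c, hc, hab, hac, hbc⟩ := hc
      rw [Finset.mem_bipartiteBelow] at ha hb hc
      obtain ⟨-, u, hu0, huy, huu, rfl⟩ := aux_rebase B hs a (hL a ha.1).1 y ha.2
      obtain ⟨-, v, hv0, hvy, hvv, rfl⟩ := aux_rebase B hs b (hL b hb.1).1 y hb.2
      obtain ⟨-, w, hw0, hwy, hww, rfl⟩ := aux_rebase B hs c (hL c hc.1).1 y hc.2
      have hun := hnW u (hdir y u (hL _ ha.1).2)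
      have hvn := hnW v (hdir y v (hL _ hb.1).2)
      have hwn := hnW w (hdir y w (hL _ hc.1).2)
      have huv : LinearIndependent F ![u, v] := by
        rw [LinearIndependent.pair_iff' hu0]
        intro r hr
        have hr0 : r ≠ 0 := by rintro rfl; simp at hr; exact hv0 hr.symm
        exact hab (aux_line_eq y u v r hr0 hr.symm).symm
      rcases aux_three h2 B hs hn n y u v w hny hyy hw0 huu hvv hww huy hvy hwy hun hvn hwn huv
        with ⟨r, hr0, hr⟩ | ⟨r, hr0, hr⟩
      · exact hac (aux_line_eq y u w r hr0 hr).symm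
      · exact hbc (aux_line_eq y v w r hr0 hr).symm)
  have hq : 2 ≤ Fintype.card F := Fintype.one_lt_card
  obtain ⟨m, hm⟩ : ∃ m, Fintype.card F = m + 2 := ⟨_, (Nat.sub_add_cancel hq).symm⟩
  rw [hm] at key hS ⊢
  have e : m + 2 - 1 = m + 1 := rfl
  rw [e] at key
  by_contra hc
  push Not at hc
  nlinarith

/-- every 3-dimensional affine subspace of `F^4` contains at most
`C · |F|` lines of the quadric family `L`; in particular `L` obeys the Wolff axiom. -/
theorem quadric_lines_wolff_axiom :
    ∃ C : ℝ, 0 < C ∧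
      ∀ (F : Type) [Field F] [Fintype F], 2 < ringChar F →
        ∀ B : (Fin 4 → F) →ₗ[F] (Fin 4 → F) →ₗ[F] F,
          (∀ x y : Fin 4 → F, B x y = B y x) →
          (∀ x : Fin 4 → F, (∀ y : Fin 4 → F, B x y = 0) → x = 0) →
          ∀ lam : Set (Fin 4 → F), IsAffineDim F 3 lam →
            ({l ∈ quadricLines F B | l ⊆ lam}.ncard : ℝ) ≤ C * (Fintype.card F : ℝ) := by
  refine ⟨8, by norm_num, ?_⟩
  intro F _ _ hchar B hs hn lam hlam
  classical
  obtain ⟨W, p, hW, rfl⟩ := hlam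
  have h2 : (2 : F) ≠ 0 := Ring.two_ne_zero (by omega)
  have hfin : {l ∈ quadricLines F B | l ⊆ (fun w => p + w) '' (W : Set (Fin 4 → F))}.Finite :=
    Set.toFinite _
  rw [Set.ncard_eq_toFinset_card _ hfin]
  have := aux_main h2 B hs hn W p hW hfin.toFinset (by
    intro l hl
    rw [Set.Finite.mem_toFinset] at hl
    refine ⟨hl.1, fun y hy => ?_⟩
    obtain ⟨z, hz, rfl⟩ := hl.2 hy
    simpa using hz)
  exact_mod_cast this
end

section
/- There is an absolute constant C such that the following holds (three-line lemma). Let F be a finite field with char(F) > 2, and let l1, l2, l3 be pairwise skew lines in F^3. Then the number of lines in any family L of lines of F^3 pointing in different directions, each of which intersects all three of l1, l2, l3, is at most C·|F|. -/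
open Set

lemma not_skew_aux {F : Type} [Field F] {l₁ l₂ : Set (Fin 3 → F)} (x a b : Fin 3 → F) (ha : a ≠ 0)
    (h₁ : ∀ y ∈ l₁, ∃ s t : F, y = x + (s • a + t • b))
    (h₂ : ∀ y ∈ l₂, ∃ s t : F, y = x + (s • a + t • b)) : ¬ SkewLines F l₁ l₂ := by
  intro h
  apply h
  have key : ∃ b' : Fin 3 → F, LinearIndependent F ![a, b'] ∧
      ∀ s t : F, s • a + t • b ∈ Submodule.span F {a, b'} := by
    by_cases hb : LinearIndependent F ![a, b]
    · exact ⟨b, hb, fun s t => Submodule.mem_span_pair.2 ⟨s, t, rfl⟩⟩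
    · rw [LinearIndependent.pair_iff' ha] at hb
      push Not at hb
      obtain ⟨c, rfl⟩ := hb
      obtain ⟨b', hb'⟩ := exists_linearIndependent_pair_of_one_lt_finrank
        (R := F) (M := Fin 3 → F) (by simp) ha
      refine ⟨b', hb', fun s t => Submodule.mem_span_pair.2 ⟨s + t * c, 0, ?_⟩⟩
      rw [zero_smul, add_zero, add_smul, mul_smul]
  obtain ⟨b', hb', hm⟩ := key
  refine ⟨_, ⟨Submodule.span F {a, b'}, x, ?_, rfl⟩, ?_, ?_⟩
  · have := finrank_span_eq_card hb'
    rw [Matrix.range_cons_cons_empty] at this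
    simpa using this
  · intro y hy
    obtain ⟨s, t, rfl⟩ := h₁ y hy
    exact ⟨_, hm s t, rfl⟩
  · intro y hy
    obtain ⟨s, t, rfl⟩ := h₂ y hy
    exact ⟨_, hm s t, rfl⟩

/-- Rebase a line at one of its points. -/
lemma line_rebase {F : Type} [Field F] {l : Set (Fin 3 → F)} (h : IsLine F l) {p : Fin 3 → F}
    (hp : p ∈ l) : ∃ v : Fin 3 → F, v ≠ 0 ∧ l = {y | ∃ t : F, y = p + t • v} := by
  obtain ⟨x, v, hv, rfl⟩ := h
  obtain ⟨s, rfl⟩ := hp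
  refine ⟨v, hv, ?_⟩
  ext y
  constructor
  · rintro ⟨t, rfl⟩
    exact ⟨t - s, by rw [sub_smul]; abel⟩
  · rintro ⟨t, rfl⟩
    exact ⟨s + t, by rw [add_smul]; abel⟩

/-- A line through two distinct points is determined by them. -/
lemma line_two {F : Type} [Field F] {l : Set (Fin 3 → F)} (h : IsLine F l) {p q : Fin 3 → F}
    (hp : p ∈ l) (hq : q ∈ l) (hpq : p ≠ q) : l = {y | ∃ t : F, y = p + t • (q - p)} := by
  obtain ⟨v, hv, rfl⟩ := line_rebase h hp
  obtain ⟨s, rfl⟩ := hq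
  have hs : s ≠ 0 := by
    rintro rfl
    simp at hpq
  ext y
  constructor
  · rintro ⟨t, rfl⟩
    refine ⟨t / s, ?_⟩
    rw [add_sub_cancel_left, smul_smul, div_mul_cancel₀ _ hs]
  · rintro ⟨t, rfl⟩
    refine ⟨t * s, ?_⟩
    rw [add_sub_cancel_left, smul_smul]

lemma skew_disj {F : Type} [Field F] {l₁ l₂ : Set (Fin 3 → F)} (h₁ : IsLine F l₁)
    (h₂ : IsLine F l₂) (h : SkewLines F l₁ l₂) {p q : Fin 3 → F} (hp : p ∈ l₁) (hq : q ∈ l₂) :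
    p ≠ q := by
  rintro rfl
  obtain ⟨v, hv, e₁⟩ := line_rebase h₁ hp
  obtain ⟨w, hw, e₂⟩ := line_rebase h₂ hq
  refine not_skew_aux p v w hv ?_ ?_ h
  · intro y hy
    rw [e₁] at hy
    obtain ⟨t, rfl⟩ := hy
    exact ⟨t, 0, by simp⟩
  · intro y hy
    rw [e₂] at hy
    obtain ⟨t, rfl⟩ := hy
    exact ⟨0, t, by simp⟩

lemma line_in_plane {F : Type} [Field F] {l m m' : Set (Fin 3 → F)} {p u u' q q' : Fin 3 → F}
    (hl : IsLine F l) (hm : IsLine F m) (hm' : IsLine F m')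
    (e : m = {y | ∃ t : F, y = p + t • u}) (e' : m' = {y | ∃ t : F, y = p + t • u'})
    (hne : m ≠ m') (hq : q ∈ m) (hq' : q' ∈ m') (hql : q ∈ l) (hql' : q' ∈ l) (hpq : p ≠ q) :
    ∀ y ∈ l, ∃ s t : F, y = p + (s • u + t • u') := by
  have hqq : q ≠ q' := by
    rintro rfl
    apply hne
    rw [line_two hm (p := p) (by rw [e]; exact ⟨0, by simp⟩) hq hpq,
      line_two hm' (p := p) (by rw [e']; exact ⟨0, by simp⟩) hq' hpq]
  rw [line_two hl hql hql' hqq]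
  rintro y ⟨t, rfl⟩
  rw [e] at hq
  rw [e'] at hq'
  obtain ⟨a, rfl⟩ := hq
  obtain ⟨b, rfl⟩ := hq'
  refine ⟨a - t * a, t * b, ?_⟩
  ext i
  simp
  ring

/-- three-line lemma: given three pairwise skew lines in `F^3`, at most
`C · |F|` lines of a family pointing in different directions meet all three. -/
theorem three_line_lemma :
    ∃ C : ℝ, 0 < C ∧
      ∀ (F : Type) [Field F] [Fintype F], 2 < ringChar F →
        ∀ l₁ l₂ l₃ : Set (Fin 3 → F),
          IsLine F l₁ → IsLine F l₂ → IsLine F l₃ →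
          SkewLines F l₁ l₂ → SkewLines F l₁ l₃ → SkewLines F l₂ l₃ →
          ∀ L : Set (Set (Fin 3 → F)), (∀ l ∈ L, IsLine F l) → DiffDirections F L →
            ({l ∈ L | (l ∩ l₁).Nonempty ∧ (l ∩ l₂).Nonempty ∧
                (l ∩ l₃).Nonempty}.ncard : ℝ) ≤ C * (Fintype.card F : ℝ) := by
  refine ⟨1, one_pos, ?_⟩
  intro F _ _ _ l₁ l₂ l₃ h₁ h₂ h₃ h₁₂ h₁₃ h₂₃ L hL _
  rw [one_mul]
  norm_cast
  have hc : l₁.ncard ≤ Fintype.card F := by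
    obtain ⟨x, v, hv, rfl⟩ := h₁
    have : {y | ∃ t : F, y = x + t • v} = (fun t : F => x + t • v) '' Set.univ := by
      ext y
      simp [eq_comm]
    rw [this]
    refine (Set.ncard_image_le Set.finite_univ).trans ?_
    rw [Set.ncard_univ, Nat.card_eq_fintype_card]
  refine le_trans ?_ hc
  classical
  have hex : ∀ l : Set (Fin 3 → F), ∃ p, (l ∩ l₁).Nonempty → p ∈ l ∩ l₁ := by
    intro l
    by_cases h : (l ∩ l₁).Nonempty
    · exact ⟨h.some, fun _ => h.some_mem⟩
    · exact ⟨0, fun h' => absurd h' h⟩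
  choose f hf using hex
  refine Set.ncard_le_ncard_of_injOn f (fun l hl => (hf l hl.2.1).2) ?_ (Set.toFinite _)
  rintro m ⟨hm, hm1, ⟨q, hq, hq2⟩, ⟨r, hr, hr3⟩⟩ m' ⟨hm', hm1', ⟨q', hq', hq2'⟩, ⟨r', hr', hr3'⟩⟩ hff
  by_contra hne
  have hp := hf m hm1
  have hp' := hf m' hm1'
  rw [← hff] at hp'
  obtain ⟨u, hu, e⟩ := line_rebase (hL m hm) hp.1
  obtain ⟨u', hu', e'⟩ := line_rebase (hL m' hm') hp'.1
  exact not_skew_aux _ u u' hu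
    (line_in_plane h₂ (hL m hm) (hL m' hm') e e' hne hq hq' hq2 hq2' (skew_disj h₁ h₂ h₁₂ hp.2 hq2))
    (line_in_plane h₃ (hL m hm) (hL m' hm') e e' hne hr hr' hr3 hr3' (skew_disj h₁ h₃ h₁₃ hp.2 hr3))
    h₂₃
end

section
/- There are absolute constants c, C > 0 such that the following holds. Let F be a finite field with char(F) > 2 with |F| sufficiently large, and let f = (l1, l2, l3, λ) be a frame in F^4. Then the set L(f) of lines of F^4 intersecting each of l1, l2, l3 satisfies c·|F| ≤ |L(f)| ≤ C·|F|. -/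
open Set

theorem fl_extend {F : Type*} [Field F] (U : Submodule F (Fin 4 → F))
    (h : Module.finrank F U ≤ 2) :
    ∃ W : Submodule F (Fin 4 → F), U ≤ W ∧ Module.finrank F W = 2 := by
  have step : ∀ U : Submodule F (Fin 4 → F), Module.finrank F U < 2 →
      ∃ W : Submodule F (Fin 4 → F), U ≤ W ∧ Module.finrank F W = Module.finrank F U + 1 := by
    intro U hU
    have hne : ∃ v, v ∉ U := by
      by_contra hcon
      push Not at hcon
      have : U = ⊤ := by
        ext v
        simp [hcon v]
      rw [this, finrank_top] at hU
      simp at hU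
    obtain ⟨v, hv⟩ := hne
    exact ⟨U ⊔ Submodule.span F {v}, le_sup_left, Submodule.finrank_sup_span_singleton hv⟩
  by_cases h2 : Module.finrank F U = 2
  · exact ⟨U, le_rfl, h2⟩
  obtain ⟨W, hW, hW2⟩ := step U (by omega)
  by_cases h3 : Module.finrank F W = 2
  · exact ⟨W, hW, h3⟩
  obtain ⟨X, hX, hX2⟩ := step W (by omega)
  exact ⟨X, hW.trans hX, by omega⟩

theorem fl_skew {F : Type*} [Field F] {x₁ v₁ x₂ v₂ : Fin 4 → F}
    (h : SkewLines F {y | ∃ t : F, y = x₁ + t • v₁} {y | ∃ t : F, y = x₂ + t • v₂})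
    (U : Submodule F (Fin 4 → F)) (hU : Module.finrank F U ≤ 2)
    (h1 : v₁ ∈ U) (h2 : v₂ ∈ U) (h3 : x₂ - x₁ ∈ U) : False := by
  obtain ⟨W, hW, hW2⟩ := fl_extend U hU
  refine h ⟨_, ⟨W, x₁, hW2, rfl⟩, ?_, ?_⟩
  · rintro y ⟨t, rfl⟩
    exact ⟨t • v₁, W.smul_mem _ (hW h1), rfl⟩
  · rintro y ⟨t, rfl⟩
    exact ⟨(x₂ - x₁) + t • v₂, W.add_mem (hW h3) (W.smul_mem _ (hW h2)), by simp only; abel⟩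

theorem fl_pair {F : Type*} [Field F] (p q : Fin 4 → F) :
    Module.finrank F (Submodule.span F {p, q}) ≤ 2 := by
  classical
  have := finrank_span_finset_le_card (R := F) ({p, q} : Finset (Fin 4 → F))
  have h2 := Finset.card_le_two (a := p) (b := q)
  have e : ((({p, q} : Finset (Fin 4 → F))) : Set (Fin 4 → F)) = {p, q} := Finset.coe_pair
  rw [e, Set.finrank] at this
  omega

theorem fl_li {F : Type*} [Field F] {x₁ v₁ x₂ v₂ : Fin 4 → F}
    (h : SkewLines F {y | ∃ t : F, y = x₁ + t • v₁} {y | ∃ t : F, y = x₂ + t • v₂}) :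
    LinearIndependent F ![v₁, v₂, x₂ - x₁] := by
  rw [linearIndependent_iff_card_le_finrank_span]
  by_contra hcon
  rw [Fintype.card_fin, Set.finrank] at hcon
  refine fl_skew h (Submodule.span F (Set.range ![v₁, v₂, x₂ - x₁])) (by omega) ?_ ?_ ?_
  · exact Submodule.subset_span ⟨0, rfl⟩
  · exact Submodule.subset_span ⟨1, rfl⟩
  · exact Submodule.subset_span ⟨2, rfl⟩

/-- skew lines are disjoint -/
theorem fl_disj {F : Type*} [Field F] {x₁ v₁ x₂ v₂ : Fin 4 → F}
    (h : SkewLines F {y | ∃ t : F, y = x₁ + t • v₁} {y | ∃ t : F, y = x₂ + t • v₂})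
    (s t : F) (he : x₁ + s • v₁ = x₂ + t • v₂) : False := by
  refine fl_skew h _ (fl_pair v₁ v₂) (Submodule.subset_span (by simp))
    (Submodule.subset_span (by simp)) ?_
  rw [Submodule.mem_span_pair]
  refine ⟨s, -t, ?_⟩
  rw [neg_smul, ← sub_eq_add_neg, sub_eq_sub_iff_add_eq_add, add_comm, he]

theorem fl_line {F : Type*} [Field F] {l : Set (Fin 4 → F)} (hl : IsLine F l)
    {p q : Fin 4 → F} (hp : p ∈ l) (hq : q ∈ l) (hpq : p ≠ q) :
    l = {y | ∃ t : F, y = p + t • (q - p)} := by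
  obtain ⟨x, v, hv, rfl⟩ := hl
  obtain ⟨a, rfl⟩ := hp
  obtain ⟨b, rfl⟩ := hq
  have hab : b - a ≠ 0 := by
    intro h
    apply hpq
    rw [sub_eq_zero.mp h]
  have e : x + b • v - (x + a • v) = (b - a) • v := by module
  rw [e]
  ext y
  constructor
  · rintro ⟨t, rfl⟩
    refine ⟨(t - a) / (b - a), ?_⟩
    rw [smul_smul, div_mul_cancel₀ _ hab]
    module
  · rintro ⟨t, rfl⟩
    exact ⟨a + t * (b - a), by module⟩

theorem fl_main (F : Type) [Field F] [Fintype F] (l₁ l₂ l₃ lam : Set (Fin 4 → F))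
    (hf : IsFrame F l₁ l₂ l₃ lam) :
    Fintype.card F ≤ (frameLines F l₁ l₂ l₃).ncard + 2 ∧
    (frameLines F l₁ l₂ l₃).ncard ≤ Fintype.card F := by
  classical
  obtain ⟨⟨x₁, v₁, hv₁, rfl⟩, ⟨x₂, v₂, hv₂, rfl⟩, ⟨x₃, v₃, hv₃, rfl⟩, ⟨W, z, hW, rfl⟩,
    s1, s2, s3, k12, k13, k23⟩ := hf
  -- vectors are in W
  have key : ∀ x v : Fin 4 → F, {y | ∃ t : F, y = x + t • v} ⊆
      (fun w => z + w) '' (W : Set (Fin 4 → F)) → x - z ∈ W ∧ v ∈ W := by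
    intro x v h
    obtain ⟨w, hw, e⟩ := h ⟨0, rfl⟩
    obtain ⟨w', hw', e'⟩ := h ⟨1, rfl⟩
    simp only [zero_smul, add_zero, one_smul] at e e'
    have hx : x - z = w := by rw [← e]; abel
    refine ⟨hx ▸ hw, ?_⟩
    have : v = w' - w := by
      rw [← hx, sub_sub_eq_add_sub, add_comm w' z, e']; abel
    rw [this]
    exact W.sub_mem hw' hw
  obtain ⟨w1, w1'⟩ := key _ _ s1
  obtain ⟨w2, w2'⟩ := key _ _ s2
  obtain ⟨w3, w3'⟩ := key _ _ s3
  have d2 : x₂ - x₁ ∈ W := by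
    have := W.sub_mem w2 w1
    simpa using this
  have d3 : x₃ - x₁ ∈ W := by
    have := W.sub_mem w3 w1
    simpa using this
  have li := fl_li k12
  obtain ⟨d, hd⟩ : ∃ d, d = x₂ - x₁ := ⟨_, rfl⟩
  rw [← hd] at li d2
  have hx2 : x₂ = x₁ + d := by rw [hd]; abel
  have hr : Set.range ![v₁, v₂, d] = {v₁, v₂, d} := by
    ext y
    simp only [Set.mem_range, Fin.exists_fin_succ, Set.mem_insert_iff, Set.mem_singleton_iff]
    simp [eq_comm]
  have hspan : Submodule.span F {v₁, v₂, d} = W := by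
    apply Submodule.eq_of_le_of_finrank_eq
    · rw [Submodule.span_le]
      rintro y (rfl | rfl | rfl) <;> assumption
    · rw [hW, ← hr, finrank_span_eq_card li, Fintype.card_fin]
  have hli : ∀ a b c a' b' c' : F, a • v₁ + b • v₂ + c • d = a' • v₁ + b' • v₂ + c' • d →
      a = a' ∧ b = b' ∧ c = c' := by
    intro a b c a' b' c' h
    have := Fintype.linearIndependent_iff.mp li ![a - a', b - b', c - c'] (by
      simp only [Fin.sum_univ_three, Matrix.cons_val]
      rw [← sub_eq_zero] at h
      rw [← h]
      module)
    refine ⟨sub_eq_zero.mp (this 0), sub_eq_zero.mp (this 1), sub_eq_zero.mp (this 2)⟩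
  rw [← hspan, Submodule.mem_span_triple] at d3 w3'
  obtain ⟨a, b, c, habc⟩ := d3
  obtain ⟨α, β, γ, hαβγ⟩ := w3'
  have hx3 : x₃ = x₁ + (a • v₁ + b • v₂ + c • d) := by rw [habc]; abel
  let S : F → F := fun r => (a + α * r) / (1 - (c + γ * r))
  let T : F → F := fun r => (b + β * r) / (c + γ * r)
  let L : F → Set (Fin 4 → F) := fun r =>
    {y | ∃ w : F, y = (x₁ + S r • v₁) + w • ((x₂ + T r • v₂) - (x₁ + S r • v₁))}
  let A : Finset F := Finset.univ.filter fun r => c + γ * r ≠ 0 ∧ c + γ * r ≠ 1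
  have hpt : ∀ r ∈ A, x₃ + r • v₃ ∈ L r := by
    intro r hr
    simp only [A, Finset.mem_filter, Finset.mem_univ, true_and] at hr
    obtain ⟨h0, h1⟩ := hr
    have h1' : 1 - (c + γ * r) ≠ 0 := fun h => h1 (sub_eq_zero.mp h).symm
    refine ⟨c + γ * r, ?_⟩
    have eS : S r * (1 - (c + γ * r)) = a + α * r := div_mul_cancel₀ _ h1'
    have eT : T r * (c + γ * r) = b + β * r := div_mul_cancel₀ _ h0
    rw [hx3, hx2, ← hαβγ]
    have : x₁ + S r • v₁ + (c + γ * r) • (x₁ + d + T r • v₂ - (x₁ + S r • v₁))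
      = x₁ + ((S r * (1 - (c + γ * r))) • v₁ + (T r * (c + γ * r)) • v₂ + (c + γ * r) • d) := by
      module
    rw [this, eS, eT]
    module
  have hmem1 : ∀ r, x₁ + S r • v₁ ∈ L r := fun r => ⟨0, by simp⟩
  have hmem2 : ∀ r, x₂ + T r • v₂ ∈ L r := fun r => ⟨1, by simp⟩
  have hline : ∀ r, IsLine F (L r) := fun r =>
    ⟨_, _, fun h => fl_disj k12 (S r) (T r) (sub_eq_zero.mp h).symm, rfl⟩
  have hsub1 : L '' (A : Set F) ⊆ frameLines F {y | ∃ t : F, y = x₁ + t • v₁}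
      {y | ∃ t : F, y = x₂ + t • v₂} {y | ∃ t : F, y = x₃ + t • v₃} := by
    rintro _ ⟨r, hr, rfl⟩
    exact ⟨hline r, ⟨_, hmem1 r, ⟨_, rfl⟩⟩, ⟨_, hmem2 r, ⟨_, rfl⟩⟩, ⟨_, hpt r hr, ⟨_, rfl⟩⟩⟩
  have hinj : Set.InjOn L (A : Set F) := by
    intro r hr r' hr' he
    by_contra hne
    have p1 := hpt r hr
    have p2 := hpt r' hr'
    rw [← he] at p2
    have hn : x₃ + r • v₃ ≠ x₃ + r' • v₃ := by
      intro h
      exact hne (smul_left_injective F hv₃ (add_left_cancel h))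
    have hL := fl_line (hline r) p1 p2 hn
    have hm := hmem1 r
    rw [hL] at hm
    obtain ⟨t, ht⟩ := hm
    refine fl_disj k13 (S r) (r + t * (r' - r)) ?_
    rw [ht]
    module
  have hsub2 : frameLines F {y | ∃ t : F, y = x₁ + t • v₁}
      {y | ∃ t : F, y = x₂ + t • v₂} {y | ∃ t : F, y = x₃ + t • v₃} ⊆ L '' Set.univ := by
    rintro l ⟨hl, ⟨_, m1, ⟨s, rfl⟩⟩, ⟨_, m2, ⟨t, rfl⟩⟩, ⟨_, m3, ⟨r, rfl⟩⟩⟩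
    have hL := fl_line hl m1 m2 (fun h => fl_disj k12 _ _ h)
    have m3' := m3
    rw [hL] at m3'
    obtain ⟨w, hw⟩ := m3'
    have hw' : (a + α * r) • v₁ + (b + β * r) • v₂ + (c + γ * r) • d =
        ((1 - w) * s) • v₁ + (w * t) • v₂ + w • d := by
      have : x₁ + ((a + α * r) • v₁ + (b + β * r) • v₂ + (c + γ * r) • d) =
          x₁ + (((1 - w) * s) • v₁ + (w * t) • v₂ + w • d) := by
        calc _ = x₃ + r • v₃ := by rw [hx3, ← hαβγ]; module
          _ = _ := by rw [hw, hx2]; module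
      exact add_left_cancel this
    obtain ⟨e1, e2, e3⟩ := hli _ _ _ _ _ _ hw'
    have hw0 : w ≠ 0 := by
      rintro rfl
      exact fl_disj k13 s r (by rw [hw]; module)
    have hw1 : 1 - w ≠ 0 := by
      intro h
      obtain rfl : w = 1 := (sub_eq_zero.mp h).symm
      exact fl_disj k23 t r (by rw [hw]; module)
    have hS : S r = s := by
      simp only [S]
      rw [e1, e3, mul_div_cancel_left₀ _ hw1]
    have hT : T r = t := by
      simp only [T]
      rw [e2, e3, mul_div_cancel_left₀ _ hw0]
    refine ⟨r, trivial, ?_⟩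
    simp only [L]
    rw [hS, hT, hL]
  have hA : Fintype.card F ≤ A.card + 2 := by
    by_cases hγ : γ = 0
    · have : A = Finset.univ := by
        apply Finset.filter_true_of_mem
        intro r _
        subst hγ
        simp only [zero_mul, add_zero, zero_smul] at *
        constructor
        · rintro rfl
          refine fl_skew k13 _ (fl_pair v₁ v₂) (Submodule.subset_span (by simp)) ?_ ?_
          · exact Submodule.mem_span_pair.mpr ⟨α, β, hαβγ⟩
          · exact Submodule.mem_span_pair.mpr ⟨a, b, by rw [← habc]; module⟩
        · rintro rfl
          refine fl_skew k23 _ (fl_pair v₁ v₂) (Submodule.subset_span (by simp)) ?_ ?_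
          · exact Submodule.mem_span_pair.mpr ⟨α, β, hαβγ⟩
          · exact Submodule.mem_span_pair.mpr ⟨a, b, by rw [hx3, hx2]; module⟩
      rw [this, Finset.card_univ]
      omega
    · have hun : (Finset.univ : Finset F) ⊆ A ∪ {-c / γ, (1 - c) / γ} := by
        intro r _
        by_contra hr
        simp only [A, Finset.mem_union, Finset.mem_filter, Finset.mem_univ, true_and,
          Finset.mem_insert, Finset.mem_singleton, not_or, eq_div_iff hγ] at hr
        obtain ⟨h, h2, h3⟩ := hr
        apply h
        constructor
        · intro h
          apply h2
          linear_combination h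
        · intro h
          apply h3
          linear_combination h
      have := Finset.card_le_card hun
      have h2 := Finset.card_union_le A {-c / γ, (1 - c) / γ}
      have h3 := Finset.card_le_two (a := -c / γ) (b := (1 - c) / γ)
      rw [Finset.card_univ] at this
      omega
  constructor
  · have h1 := Set.ncard_le_ncard hsub1 (Set.toFinite _)
    rw [hinj.ncard_image, Set.ncard_coe_finset] at h1
    omega
  · have h1 := Set.ncard_le_ncard hsub2 (Set.toFinite _)
    have h2 := Set.ncard_image_le (f := L) (Set.toFinite (Set.univ : Set F))
    rw [Set.ncard_univ, Nat.card_eq_fintype_card] at h2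
    omega

/-- for a frame `f` in `F^4` and `|F|` large, the set `L(f)` of lines
meeting all three lines of the frame satisfies `c·|F| ≤ |L(f)| ≤ C·|F|`. -/
theorem frame_lines_cardinality :
    ∃ c C : ℝ, 0 < c ∧ 0 < C ∧ ∃ N : ℕ,
      ∀ (F : Type) [Field F] [Fintype F], 2 < ringChar F → N ≤ Fintype.card F →
        ∀ l₁ l₂ l₃ lam : Set (Fin 4 → F), IsFrame F l₁ l₂ l₃ lam →
          c * (Fintype.card F : ℝ) ≤ ((frameLines F l₁ l₂ l₃).ncard : ℝ) ∧
          ((frameLines F l₁ l₂ l₃).ncard : ℝ) ≤ C * (Fintype.card F : ℝ) := by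
  refine ⟨1 / 2, 1, by norm_num, by norm_num, 4, ?_⟩
  intro F _ _ _ hN l₁ l₂ l₃ lam hf
  obtain ⟨h1, h2⟩ := fl_main F l₁ l₂ l₃ lam hf
  have h1' : (Fintype.card F : ℝ) ≤ (frameLines F l₁ l₂ l₃).ncard + 2 := by exact_mod_cast h1
  have h2' : ((frameLines F l₁ l₂ l₃).ncard : ℝ) ≤ Fintype.card F := by exact_mod_cast h2
  have h3' : (4 : ℝ) ≤ Fintype.card F := by exact_mod_cast hN
  constructor <;> linarith
end

section
/- For every ε > 0 there exists C(ε) > 0 such that the following holds (three regulus lemma). Let F be a finite field with char(F) > 2, let L be a family of lines in F^4 pointing in different directions, let P ⊆ F^4 contain every line of L, and let f1, f2, f3 be frames in F^4 such that the 3-dimensional affine subspaces λ(f1), λ(f2), λ(f3) are pairwise disjoint translates of one another. Then the number of lines l ∈ L with l ∩ r(fi) ≠ ∅ for all i = 1, 2, 3 is at most C(ε)·|F|^ε·(|F|² + |P|/|F|). -/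
open Set

open Finset in
lemma exists_downset (F : Type) [Field F] [Fintype F] (Ω : Finset (Fin 4 → F)) :
    ∃ D : Finset (Fin 4 → ℕ), Ω.card ≤ D.card ∧ (∀ a ∈ D, ∀ b, b ≤ a → b ∈ D) ∧
      (∀ a ∈ D, ∀ i, a i < Fintype.card F) ∧
      (∀ c : (Fin 4 → ℕ) → F, (∀ v ∈ Ω, ∑ a ∈ D, c a * ∏ i, v i ^ a i = 0) →
        ∀ a ∈ D, c a = 0) := by
  classical
  let e : Lex (Fin 4 → ℕ) → (Ω → F) := fun a v => ∏ i, v.1 i ^ (ofLex a) i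
  have e_add : ∀ a b, e (a + b) = e a * e b := by
    intro a b; ext v
    simp only [e, Pi.mul_apply, ← Finset.prod_mul_distrib]
    refine Finset.prod_congr rfl fun i _ => ?_
    rw [← pow_add]
    rfl
  let S : Lex (Fin 4 → ℕ) → Prop := fun a => e a ∉ Submodule.span F (e '' Set.Iio a)
  have hmul : ∀ a b, ¬ S a → ¬ S (a + b) := by
    intro a b h
    simp only [S, not_not] at h ⊢
    have h1 := Submodule.mem_map_of_mem (f := LinearMap.mulRight F (e b)) h
    rw [Submodule.map_span] at h1
    simp only [LinearMap.mulRight_apply] at h1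
    rw [← e_add] at h1
    refine Submodule.span_mono ?_ h1
    rintro _ ⟨_, ⟨c, hc, rfl⟩, rfl⟩
    refine ⟨c + b, ?_, ?_⟩
    · exact (add_lt_add_iff_right b).mpr hc
    · simp [e_add]
  have hdown : ∀ a b : Fin 4 → ℕ, b ≤ a → S (toLex a) → S (toLex b) := by
    intro a b hab ha
    by_contra hb
    apply hmul (toLex b) (toLex (a - b)) (not_not.2 hb)
    rwa [← toLex_add, add_tsub_cancel_of_le hab]
  have hq : ∀ a : Fin 4 → ℕ, S (toLex a) → ∀ i, a i < Fintype.card F := by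
    intro a ha i
    by_contra! hi
    have h1 : Pi.single i (Fintype.card F) ≤ a := by
      intro j
      by_cases hj : j = i
      · subst hj; simpa using hi
      · simp [hj]
    have h2 := hdown _ _ h1 ha
    apply h2
    apply Submodule.subset_span
    refine ⟨toLex (Pi.single i 1), ?_, ?_⟩
    · apply Pi.toLex_strictMono
      exact Pi.single_strictMono i Fintype.one_lt_card
    · ext v
      simp only [e, ofLex_toLex]
      rw [Finset.prod_eq_single i, Finset.prod_eq_single i]
      · simp [FiniteField.pow_card]
      all_goals simp +contextual [Pi.single_apply]
  let D : Finset (Fin 4 → ℕ) :=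
    (Fintype.piFinset (fun _ => range (Fintype.card F))).filter (fun a => S (toLex a))
  have hD : ∀ a, a ∈ D ↔ S (toLex a) := by
    intro a
    simp only [D, Finset.mem_filter, Fintype.mem_piFinset, Finset.mem_range]
    exact ⟨fun h => h.2, fun h => ⟨hq a h, h⟩⟩
  refine ⟨D, ?_, ?_, ?_, ?_⟩
  · have hsp : ∀ a, e a ∈ Submodule.span F ((D.image (fun a => e (toLex a)) : Finset (Ω → F)) : Set (Ω → F)) := by
      intro a
      induction a using WellFoundedLT.induction with
      | ind a ih =>
        by_cases ha : S a
        · apply Submodule.subset_span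
          rw [Finset.mem_coe, Finset.mem_image]
          exact ⟨ofLex a, (hD _).2 ha, rfl⟩
        · simp only [S, not_not] at ha
          refine Submodule.span_le.2 ?_ ha
          rintro _ ⟨b, hb, rfl⟩
          exact ih b hb
    have htop : Submodule.span F ((D.image (fun a => e (toLex a)) : Finset (Ω → F)) : Set (Ω → F)) = ⊤ := by
      rw [eq_top_iff]
      intro g _
      let g' : (Fin 4 → F) → F := fun v => if h : v ∈ Ω then g ⟨v, h⟩ else 0
      have : g' ∈ Submodule.map (MvPolynomial.evalₗ F (Fin 4)) (MvPolynomial.restrictDegree (Fin 4) F (Fintype.card F - 1)) := by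
        rw [MvPolynomial.map_restrict_dom_evalₗ]; trivial
      obtain ⟨p, -, hp⟩ := this
      have : g = ∑ d ∈ p.support, MvPolynomial.coeff d p • e (toLex (d : Fin 4 → ℕ)) := by
        ext v
        have h1 := congrFun hp v.1
        simp only [MvPolynomial.evalₗ_apply, g', v.2, dite_true] at h1
        rw [← h1, MvPolynomial.eval_eq']
        simp [e]
      rw [this]
      exact Submodule.sum_mem _ fun d _ => Submodule.smul_mem _ _ (hsp _)
    have h1 := finrank_span_finset_le_card (R := F) (D.image (fun a => e (toLex a)))
    rw [Set.finrank, htop, finrank_top, Module.finrank_fintype_fun_eq_card, Fintype.card_coe] at h1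
    exact h1.trans Finset.card_image_le
  · intro a ha b hab
    rw [hD] at ha ⊢
    exact hdown a b hab ha
  · intro a ha
    exact hq a ((hD a).1 ha)
  · intro c hc
    by_contra! hne
    obtain ⟨a0, ha0, hca0⟩ := hne
    obtain ⟨a, ha, hmax⟩ := Finset.exists_max_image (D.filter (fun a => c a ≠ 0)) (fun a => toLex a)
      ⟨a0, by simp [ha0, hca0]⟩
    rw [Finset.mem_filter] at ha
    apply (hD a).1 ha.1
    have hsum : ∑ b ∈ D, c b • e (toLex b) = 0 := by
      ext v
      simpa [e] using hc v.1 v.2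
    rw [← Finset.add_sum_erase _ _ ha.1] at hsum
    have : e (toLex a) = - (c a)⁻¹ • ∑ b ∈ D.erase a, c b • e (toLex b) := by
      rw [← neg_eq_iff_add_eq_zero.2 hsum]
      rw [smul_neg, neg_smul, neg_neg, smul_smul, inv_mul_cancel₀ ha.2, one_smul]
    rw [this]
    refine Submodule.smul_mem _ _ (Submodule.sum_mem _ ?_)
    intro b hb
    rw [Finset.mem_erase] at hb
    by_cases hcb : c b = 0
    · simp [hcb]
    · refine Submodule.smul_mem _ _ (Submodule.subset_span ⟨toLex b, ?_, rfl⟩)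
      refine lt_of_le_of_ne (hmax b (by simp [hb.2, hcb])) ?_
      intro h
      exact hb.1 (toLex.injective h)

open Polynomial in
lemma lead_mul {F : Type} [Field F] {p r : F[X]} {m n : ℕ} {c d : F}
    (hp : p.natDegree ≤ m ∧ p.coeff m = c) (hr : r.natDegree ≤ n ∧ r.coeff n = d) :
    (p * r).natDegree ≤ m + n ∧ (p * r).coeff (m + n) = c * d := by
  refine ⟨natDegree_mul_le_of_le hp.1 hr.1, ?_⟩
  rw [coeff_mul_add_eq_of_natDegree_le hp.1 hr.1, hp.2, hr.2]

open Polynomial in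
lemma lead_pow {F : Type} [Field F] (x v : F) (k : ℕ) :
    ((C x + C v * X) ^ k).natDegree ≤ k ∧ ((C x + C v * X) ^ k).coeff k = v ^ k := by
  induction k with
  | zero => simp
  | succ k ih =>
    rw [pow_succ, pow_succ]
    refine lead_mul ih ⟨?_, by simp⟩
    rw [add_comm]
    exact natDegree_linear_le

open Polynomial in
lemma lead_G {F : Type} [Field F] (x v : Fin 4 → F) (i : Fin 4) (hv : v i = 1)
    (a : Fin 4 → ℕ) (k : ℕ) (hk : ∑ j, a j ≤ k) :
    ((C (x i) + C (v i) * X) ^ (k - ∑ j, a j) * ∏ j, (C (x j) + C (v j) * X) ^ a j).natDegree ≤ k ∧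
    ((C (x i) + C (v i) * X) ^ (k - ∑ j, a j) * ∏ j, (C (x j) + C (v j) * X) ^ a j).coeff k =
      ∏ j, v j ^ a j := by
  have h := lead_mul (lead_pow (x i) (v i) (k - ∑ j, a j))
    (lead_mul (lead_mul (lead_mul (lead_pow (x 0) (v 0) (a 0)) (lead_pow (x 1) (v 1) (a 1)))
      (lead_pow (x 2) (v 2) (a 2))) (lead_pow (x 3) (v 3) (a 3)))
  rw [← Fin.sum_univ_four, Nat.sub_add_cancel hk] at h
  rw [Fin.prod_univ_four, Fin.prod_univ_four]
  refine ⟨h.1, h.2.trans ?_⟩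
  rw [hv, one_pow, one_mul]

open Polynomial in
lemma key_indep (F : Type) [Field F] [Fintype F] (Ω P : Finset (Fin 4 → F)) (i : Fin 4)
    (hΩ : ∀ v ∈ Ω, v i = 1 ∧ ∃ x : Fin 4 → F, ∀ t : F, x + t • v ∈ P)
    (D : Finset (Fin 4 → ℕ)) (K : Finset ℕ) (hK : ∀ k ∈ K, k < Fintype.card F)
    (hDK : ∀ a ∈ D, ∀ k ∈ K, ∑ j, a j ≤ k)
    (hD : ∀ c : (Fin 4 → ℕ) → F, (∀ v ∈ Ω, ∑ a ∈ D, c a * ∏ i, v i ^ a i = 0) →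
        ∀ a ∈ D, c a = 0) : D.card * K.card ≤ P.card := by
  classical
  let b : (Fin 4 → ℕ) × ℕ → (P → F) := fun s y => y.1 i ^ (s.2 - ∑ j, s.1 j) * ∏ j, y.1 j ^ s.1 j
  have hli : LinearIndepOn F b ((D ×ˢ K : Finset _) : Set ((Fin 4 → ℕ) × ℕ)) := by
    rw [linearIndepOn_finset_iff]
    intro c hc
    have main : ∀ n k, Fintype.card F - k = n → k ∈ K → ∀ a ∈ D, c (a, k) = 0 := by
      intro n
      induction n using Nat.strong_induction_on with
      | _ n ih =>
        intro k hkn hk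
        apply hD (fun a => c (a, k))
        intro v hv
        obtain ⟨hvi, x, hx⟩ := hΩ v hv
        let G : (Fin 4 → ℕ) × ℕ → F[X] := fun s =>
          (C (x i) + C (v i) * X) ^ (s.2 - ∑ j, s.1 j) * ∏ j, (C (x j) + C (v j) * X) ^ s.1 j
        have hG : ∀ s ∈ D ×ˢ K, (G s).natDegree ≤ s.2 ∧ (G s).coeff s.2 = ∏ j, v j ^ s.1 j := by
          intro s hs
          rw [Finset.mem_product] at hs
          exact lead_G x v i hvi s.1 s.2 (hDK _ hs.1 _ hs.2)
        have hz : ∑ s ∈ D ×ˢ K, C (c s) * G s = 0 := by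
          apply eq_zero_of_natDegree_lt_card_of_eval_eq_zero' _ (Finset.univ : Finset F)
          · intro t _
            have h1 := congrFun hc ⟨x + t • v, hx t⟩
            rw [Finset.sum_apply] at h1
            rw [eval_finsetSum, ← Pi.zero_apply (M := fun _ : P => F), ← h1]
            refine Finset.sum_congr rfl fun s _ => ?_
            simp [G, b, eval_prod, mul_comm t]
          · rw [Finset.card_univ]
            have hpos : 0 < Fintype.card F := Fintype.card_pos
            have : (∑ s ∈ D ×ˢ K, C (c s) * G s).natDegree ≤ Fintype.card F - 1 := by
              apply natDegree_sum_le_of_forall_le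
              intro s hs
              refine (natDegree_C_mul_le _ _).trans ((hG s hs).1.trans ?_)
              have := hK _ (Finset.mem_product.1 hs).2
              omega
            omega
        have h2 := congrArg (fun p => coeff p k) hz
        simp only [finsetSum_coeff, coeff_C_mul, coeff_zero] at h2
        rw [Finset.sum_product_right, Finset.sum_eq_single k] at h2
        · rw [← h2]
          refine Finset.sum_congr rfl fun a ha => ?_
          rw [(hG (a, k) (Finset.mem_product.2 ⟨ha, hk⟩)).2]
        · intro k' hk' hne
          apply Finset.sum_eq_zero
          intro a ha
          rcases lt_or_gt_of_ne hne with h | h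
          · have := (hG (a, k') (Finset.mem_product.2 ⟨ha, hk'⟩)).1
            rw [coeff_eq_zero_of_natDegree_lt (lt_of_le_of_lt this h), mul_zero]
          · have h4 := hK _ hk'
            rw [ih (Fintype.card F - k') (by omega) k' rfl hk' a ha, zero_mul]
        · intro h; exact absurd hk h
    rintro ⟨a, k⟩ hs
    rw [Finset.mem_product] at hs
    exact main _ k rfl hs.2 a hs.1
  have h := LinearIndependent.fintype_card_le_finrank hli
  rw [Module.finrank_fintype_fun_eq_card, Fintype.card_coe] at h
  rw [← Finset.card_product]
  simpa using h

lemma key_bound (F : Type) [Field F] [Fintype F] (Ω P : Finset (Fin 4 → F)) (i : Fin 4)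
    (hΩ : ∀ v ∈ Ω, v i = 1 ∧ ∃ x : Fin 4 → F, ∀ t : F, x + t • v ∈ P) :
    Ω.card * Fintype.card F ≤ 8192 * P.card := by
  classical
  obtain ⟨D, hcard, hdown, hq, hD⟩ := exists_downset F Ω
  set q := Fintype.card F with hqdef
  let D' := D.filter (fun a => ∑ j, a j ≤ (q - 1) / 2)
  have h1 : D.card ≤ D'.card * 4096 := by
    have h : D.card ≤ (D' ×ˢ Fintype.piFinset (fun _ : Fin 4 => Finset.range 8)).card := by
      apply Finset.card_le_card_of_injOn (fun a => (fun j => a j / 8, fun j => a j % 8))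
      · intro a ha
        rw [Finset.mem_coe] at ha
        rw [Finset.mem_coe, Finset.mem_product]
        refine ⟨?_, ?_⟩
        · rw [Finset.mem_filter]
          refine ⟨hdown a ha _ (fun j => Nat.div_le_self _ _), ?_⟩
          have h0 := hq a ha 0
          have h1 := hq a ha 1
          have h2 := hq a ha 2
          have h3 := hq a ha 3
          rw [Fin.sum_univ_four]
          change a 0 / 8 + a 1 / 8 + a 2 / 8 + a 3 / 8 ≤ (q - 1) / 2
          omega
        · rw [Fintype.mem_piFinset]
          intro j
          rw [Finset.mem_range]
          exact Nat.mod_lt _ (by norm_num)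
      · intro a _ b _ hab
        rw [Prod.mk.injEq] at hab
        funext j
        have h1 : a j / 8 = b j / 8 := congrFun hab.1 j
        have h2 : a j % 8 = b j % 8 := congrFun hab.2 j
        omega
    rw [Finset.card_product, Fintype.card_piFinset] at h
    simpa using h
  have h2 := key_indep F Ω P i hΩ D' (Finset.Ico ((q - 1) / 2) q)
    (fun k hk => (Finset.mem_Ico.1 hk).2)
    (fun a ha k hk => (Finset.mem_filter.1 ha).2.trans (Finset.mem_Ico.1 hk).1) (by
      intro c hc a ha
      have h := hD (fun a => if a ∈ D' then c a else 0) (by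
        intro v hv
        refine Eq.trans ?_ (hc v hv)
        simp only [D', Finset.sum_filter]
        refine Finset.sum_congr rfl fun a ha => ?_
        by_cases h : ∑ j, a j ≤ (q - 1) / 2 <;> simp [ha, h]) a (Finset.mem_filter.1 ha).1
      simpa [ha] using h)
  rw [Nat.card_Ico] at h2
  have h3 : q ≤ 2 * (q - (q - 1) / 2) := by omega
  calc Ω.card * q ≤ (D'.card * 4096) * (2 * (q - (q - 1) / 2)) := Nat.mul_le_mul (hcard.trans h1) h3
    _ = 8192 * (D'.card * (q - (q - 1) / 2)) := by ring
    _ ≤ _ := Nat.mul_le_mul_left _ h2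

lemma line_bound (F : Type) [Field F] [Fintype F] (L : Set (Set (Fin 4 → F)))
    (hL : ∀ l ∈ L, IsLine F l) (hd : DiffDirections F L) (P : Set (Fin 4 → F))
    (hP : ∀ l ∈ L, l ⊆ P) : L.ncard * Fintype.card F ≤ 32768 * P.ncard := by
  classical
  let Li : Fin 4 → Set (Set (Fin 4 → F)) := fun i =>
    {l ∈ L | ∃ x v : Fin 4 → F, v i = 1 ∧ l = {y | ∃ t : F, y = x + t • v}}
  have hcov : L ⊆ ⋃ i ∈ (Finset.univ : Finset (Fin 4)), Li i := by
    intro l hl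
    obtain ⟨x, v, hv, h⟩ := hL l hl
    obtain ⟨i, hi⟩ := Function.ne_iff.1 hv
    simp only [Pi.zero_apply] at hi
    simp only [Finset.mem_univ, Set.iUnion_true, Set.mem_iUnion]
    refine ⟨i, hl, x, (v i)⁻¹ • v, by simp [hi], ?_⟩
    rw [h]
    ext y
    constructor
    · rintro ⟨t, rfl⟩
      exact ⟨t * v i, by rw [smul_smul, mul_assoc, mul_inv_cancel₀ hi, mul_one]⟩
    · rintro ⟨t, rfl⟩
      exact ⟨t * (v i)⁻¹, by rw [smul_smul]⟩
  have hi : ∀ i, (Li i).ncard * Fintype.card F ≤ 8192 * P.ncard := by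
    intro i
    have hch : ∀ l : Set (Fin 4 → F), ∃ v : Fin 4 → F, l ∈ Li i →
        v i = 1 ∧ ∃ x, l = {y | ∃ t : F, y = x + t • v} := by
      intro l
      by_cases h : l ∈ Li i
      · obtain ⟨_, x, v, hv, h⟩ := h
        exact ⟨v, fun _ => ⟨hv, x, h⟩⟩
      · exact ⟨0, fun h' => absurd h' h⟩
    choose d hdd using hch
    have hinj : Set.InjOn d (Li i) := by
      intro l hl l' hl' heq
      by_contra hne
      apply hd l hl.1 l' hl'.1 hne
      obtain ⟨_, x, hx⟩ := hdd l hl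
      obtain ⟨_, x', hx'⟩ := hdd l' hl'
      refine ⟨x' - x, ?_⟩
      rw [hx', hx, ← heq]
      ext y
      constructor
      · rintro ⟨t, rfl⟩
        exact ⟨x + t • d l, ⟨t, rfl⟩, by simp only; abel⟩
      · rintro ⟨_, ⟨t, rfl⟩, rfl⟩
        exact ⟨t, by simp only; abel⟩
    have hfin := Set.toFinite (d '' Li i)
    have h := key_bound F (Set.toFinite (d '' Li i)).toFinset (Set.toFinite P).toFinset i (by
      intro v hv
      rw [Set.Finite.mem_toFinset] at hv
      obtain ⟨l, hl, rfl⟩ := hv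
      obtain ⟨h1, x, hx⟩ := hdd l hl
      refine ⟨h1, x, fun t => ?_⟩
      rw [Set.Finite.mem_toFinset]
      apply hP l hl.1
      exact (Set.ext_iff.1 hx _).2 ⟨t, rfl⟩)
    rwa [← Set.ncard_eq_toFinset_card, ← Set.ncard_eq_toFinset_card, Set.ncard_image_of_injOn hinj] at h
  have h1 : L.ncard ≤ ∑ i, (Li i).ncard :=
    (Set.ncard_le_ncard hcov (Set.toFinite _)).trans (Finset.set_ncard_biUnion_le _ _)
  calc L.ncard * Fintype.card F ≤ (∑ i, (Li i).ncard) * Fintype.card F := Nat.mul_le_mul_right _ h1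
    _ = ∑ i, (Li i).ncard * Fintype.card F := Finset.sum_mul _ _ _
    _ ≤ ∑ i : Fin 4, 8192 * P.ncard := Finset.sum_le_sum fun i _ => hi i
    _ = _ := by simp; ring

/-- three regulus lemma: if the 3-spaces of three frames are pairwise
disjoint translates of one another, then at most `C(ε)·|F|^ε·(|F|² + |P|/|F|)` lines
of `L` meet all three reguli. -/
theorem three_regulus_lemma :
    ∀ ε : ℝ, 0 < ε → ∃ C : ℝ, 0 < C ∧
      ∀ (F : Type) [Field F] [Fintype F], 2 < ringChar F →
        ∀ L : Set (Set (Fin 4 → F)), (∀ l ∈ L, IsLine F l) → DiffDirections F L →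
          ∀ P : Set (Fin 4 → F), (∀ l ∈ L, l ⊆ P) →
            ∀ a₁ b₁ c₁ lam₁ a₂ b₂ c₂ lam₂ a₃ b₃ c₃ lam₃ : Set (Fin 4 → F),
              IsFrame F a₁ b₁ c₁ lam₁ → IsFrame F a₂ b₂ c₂ lam₂ →
              IsFrame F a₃ b₃ c₃ lam₃ →
              IsTranslate F lam₁ lam₂ → IsTranslate F lam₁ lam₃ →
              IsTranslate F lam₂ lam₃ →
              Disjoint lam₁ lam₂ → Disjoint lam₁ lam₃ → Disjoint lam₂ lam₃ →
              ({l ∈ L | (l ∩ regulus F a₁ b₁ c₁).Nonempty ∧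
                  (l ∩ regulus F a₂ b₂ c₂).Nonempty ∧
                  (l ∩ regulus F a₃ b₃ c₃).Nonempty}.ncard : ℝ) ≤
                C * (Fintype.card F : ℝ) ^ ε *
                  ((Fintype.card F : ℝ) ^ (2 : ℕ) +
                    (P.ncard : ℝ) / (Fintype.card F : ℝ)) := by
  intro ε hε
  refine ⟨32768, by norm_num, ?_⟩
  intro F _ _ _ L hL hd P hP a₁ b₁ c₁ lam₁ a₂ b₂ c₂ lam₂ a₃ b₃ c₃ lam₃ _ _ _ _ _ _ _ _ _
  have h1 := line_bound F L hL hd P hP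
  have hq : (1 : ℝ) ≤ (Fintype.card F : ℝ) := by exact_mod_cast Fintype.card_pos (α := F)
  have hq0 : (0 : ℝ) < (Fintype.card F : ℝ) := by linarith
  have h2 : (L.ncard : ℝ) * (Fintype.card F : ℝ) ≤ 32768 * (P.ncard : ℝ) := by exact_mod_cast h1
  have h3 : (L.ncard : ℝ) ≤ 32768 * ((P.ncard : ℝ) / (Fintype.card F : ℝ)) := by
    rw [← mul_div_assoc, le_div_iff₀ hq0]
    exact h2
  have h4 : (1 : ℝ) ≤ (Fintype.card F : ℝ) ^ ε := Real.one_le_rpow hq hε.le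
  have h5 : (0 : ℝ) ≤ (P.ncard : ℝ) / (Fintype.card F : ℝ) := by positivity
  refine le_trans (Nat.cast_le.2 (Set.ncard_le_ncard (Set.sep_subset _ _) (Set.toFinite L))) ?_
  refine h3.trans ?_
  have h6 : (P.ncard : ℝ) / (Fintype.card F : ℝ) ≤
      (Fintype.card F : ℝ) ^ (2 : ℕ) + (P.ncard : ℝ) / (Fintype.card F : ℝ) := by
    have : (0 : ℝ) ≤ (Fintype.card F : ℝ) ^ (2 : ℕ) := by positivity
    linarith
  refine mul_le_mul ?_ h6 h5 (by positivity)
  linarith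
end

section
/- There is a constant C = C(n) such that the following holds. Let F be a finite field with char(F) > 2, let P ⊆ F^n be a set of points and let L be a family of lines in F^n pointing in different directions. Then |{(p, l) ∈ P × L : p ∈ l}| ≤ C·(|P|^(1/2)·|L|^(3/4)·|F|^(1/4) + |P| + |L|). -/
open Set

open Classical in
lemma aux_cs {α : Type*} (P : Finset α) (S : Finset (Set α)) :
    (∑ l ∈ S, (P.filter (fun p => p ∈ l)).card) ^ 2 ≤
      P.card * ∑ l ∈ S, ∑ l' ∈ S, (P.filter (fun p => p ∈ l ∧ p ∈ l')).card := by
  have e1 : ∑ l ∈ S, (P.filter (fun p => p ∈ l)).card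
      = ∑ p ∈ P, ∑ l ∈ S, (if p ∈ l then 1 else 0) := by
    rw [Finset.sum_comm]
    refine Finset.sum_congr rfl fun l _ => ?_
    rw [Finset.card_filter]
  have e2 : ∑ l ∈ S, ∑ l' ∈ S, (P.filter (fun p => p ∈ l ∧ p ∈ l')).card
      = ∑ p ∈ P, (∑ l ∈ S, (if p ∈ l then 1 else 0)) ^ 2 := by
    simp_rw [sq, Finset.sum_mul_sum]
    rw [Finset.sum_comm]
    rw [Finset.sum_comm (s := P)]
    rw [Finset.sum_comm]
    refine Finset.sum_congr rfl fun l _ => ?_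
    rw [Finset.sum_comm (s := P)]
    refine Finset.sum_congr rfl fun l' _ => ?_
    rw [Finset.card_filter]
    refine Finset.sum_congr rfl fun p _ => ?_
    by_cases h1 : p ∈ l <;> by_cases h2 : p ∈ l' <;> simp [h1, h2]
  rw [e1, e2]
  exact sq_sum_le_card_mul_sum_sq

open Classical in
lemma aux_row {α : Type*} (P : Finset α) (S : Finset (Set α)) (l : Set α) (hl : l ∈ S)
    (h2 : ∀ l' ∈ S, l' ≠ l → ∀ x ∈ P, ∀ y ∈ P, x ∈ l → x ∈ l' → y ∈ l → y ∈ l' → x = y) :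
    ∑ l' ∈ S, (P.filter (fun p => p ∈ l ∧ p ∈ l')).card ≤
      (P.filter (fun p => p ∈ l)).card +
      (S.filter (fun l' => l' ≠ l ∧ ∃ p ∈ P, p ∈ l ∧ p ∈ l')).card := by
  rw [← Finset.add_sum_erase S _ hl]
  refine add_le_add (by simp) ?_
  have : S.filter (fun l' => l' ≠ l ∧ ∃ p ∈ P, p ∈ l ∧ p ∈ l')
      = (S.erase l).filter (fun l' => ∃ p ∈ P, p ∈ l ∧ p ∈ l') := by
    ext x; simp only [Finset.mem_filter, Finset.mem_erase]; tauto
  rw [this, Finset.card_filter]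
  refine Finset.sum_le_sum fun l' hl' => ?_
  rw [Finset.mem_erase] at hl'
  split_ifs with h
  · rw [Finset.card_le_one]
    intro a ha b hb
    simp only [Finset.mem_filter] at ha hb
    exact h2 l' hl'.2 hl'.1 a ha.1 b hb.1 ha.2.1 ha.2.2 hb.2.1 hb.2.2
  · rw [Nat.le_zero, Finset.card_eq_zero, Finset.filter_eq_empty_iff]
    intro p hp hh
    exact h ⟨p, hp, hh⟩

open Classical in
lemma aux_comb {α : Type*} (P : Finset α) (L : Finset (Set α)) (q : ℕ)
    (h1 : ∀ l ∈ L, (P.filter (fun p => p ∈ l)).card ≤ q)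
    (h2 : ∀ l ∈ L, ∀ l' ∈ L, l' ≠ l → ∀ x y, x ∈ l → x ∈ l' → y ∈ l → y ∈ l' → x = y)
    (h3 : ∀ l₀ ∈ L, ∀ l ∈ L, l ≠ l₀ → (∃ p, p ∈ l₀ ∧ p ∈ l) →
      (L.filter (fun l' => (∃ p, p ∈ l₀ ∧ p ∈ l') ∧
        ∃ p, p ∉ l₀ ∧ p ∈ l ∧ p ∈ l')).card ≤ q)
    (I : ℝ) (hI : I = ∑ l ∈ L, ((P.filter (fun p => p ∈ l)).card : ℝ))
    (hP : 4 * (P.card : ℝ) < I) (hL : 4 * (L.card : ℝ) < I) :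
    I ^ 4 ≤ 256 * ((P.card : ℝ) ^ 2 * (L.card : ℝ) ^ 3 * q) := by
  have hP0 : (0:ℝ) ≤ P.card := by positivity
  have hL0 : (0:ℝ) ≤ L.card := by positivity
  have hIpos : 0 < I := by linarith
  set k : Set α → ℝ := fun l => ((P.filter (fun p => p ∈ l)).card : ℝ) with hk
  have hLpos : (0:ℝ) < L.card := by
    rcases Finset.eq_empty_or_nonempty L with h | h
    · subst h; simp at hI; linarith
    · exact_mod_cast h.card_pos
  have hs0 : ∑ l ∈ L.filter (fun l => I ≤ 2 * L.card * k l), k l +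
      ∑ l ∈ L.filter (fun l => ¬ (I ≤ 2 * L.card * k l)), k l = I := by
    rw [Finset.sum_filter_add_sum_filter_not]; exact hI.symm
  clear hI
  set L' := L.filter (fun l => I ≤ 2 * L.card * k l) with hL'
  set I' : ℝ := ∑ l ∈ L', k l with hI'
  have hI'2 : I ≤ 2 * I' := by
    have hb : ∑ l ∈ L.filter (fun l => ¬ (I ≤ 2 * L.card * k l)), k l ≤ I / 2 := by
      clear hs0
      calc ∑ l ∈ L.filter (fun l => ¬ (I ≤ 2 * L.card * k l)), k l
          ≤ ∑ l ∈ L.filter (fun l => ¬ (I ≤ 2 * L.card * k l)), I / (2 * L.card) := by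
            refine Finset.sum_le_sum fun l hl => ?_
            have := (Finset.mem_filter.1 hl).2
            rw [le_div_iff₀ (by positivity)]
            linarith
        _ = (L.filter (fun l => ¬ (I ≤ 2 * L.card * k l))).card * (I / (2 * L.card)) := by
            rw [Finset.sum_const, nsmul_eq_mul]
        _ ≤ L.card * (I / (2 * L.card)) := by
            gcongr
            apply Finset.filter_subset
        _ = I / 2 := by field_simp
    linarith
  have hsub : L' ⊆ L := Finset.filter_subset _ _
  -- hairbrush
  set H : Set α → Finset (Set α) := fun l =>
    L'.filter (fun l' => l' ≠ l ∧ ∃ p ∈ P, p ∈ l ∧ p ∈ l') with hH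
  have s1 : I' ^ 2 ≤ P.card * (I' + ∑ l ∈ L', ((H l).card : ℝ)) := by
    have a := aux_cs P L'
    have b : ∑ l ∈ L', ∑ l' ∈ L', (P.filter (fun p => p ∈ l ∧ p ∈ l')).card ≤
        ∑ l ∈ L', ((P.filter (fun p => p ∈ l)).card + (H l).card) := by
      refine Finset.sum_le_sum fun l hl => ?_
      exact aux_row P L' l hl fun l' hl' hne x _ y _ => h2 l (hsub hl) l' (hsub hl') hne x y
    have c := a.trans (Nat.mul_le_mul_left _ b)
    rw [Finset.sum_add_distrib] at c
    have : ((∑ l ∈ L', (P.filter (fun p => p ∈ l)).card : ℕ) : ℝ) = I' := by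
      rw [hI']; push_cast; rfl
    have c' : (((∑ l ∈ L', (P.filter (fun p => p ∈ l)).card) ^ 2 : ℕ) : ℝ) ≤ _ :=
      Nat.cast_le.2 c
    rw [Nat.cast_pow, Nat.cast_mul, Nat.cast_add, this] at c'
    simpa using c'
  have hex : ∃ l₀ ∈ L', I ^ 2 ≤ 8 * P.card * L.card * (H l₀).card := by
    by_contra hcon
    push Not at hcon
    have hne : L'.Nonempty := by
      rw [Finset.nonempty_iff_ne_empty]
      intro h
      rw [hI', h] at hI'2
      simp at hI'2; linarith
    have hlt : ∑ l ∈ L', 8 * P.card * L.card * ((H l).card : ℝ) < ∑ l ∈ L', I ^ 2 :=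
      Finset.sum_lt_sum_of_nonempty hne hcon
    rw [← Finset.mul_sum, Finset.sum_const, nsmul_eq_mul] at hlt
    have hc : (L'.card : ℝ) ≤ L.card := by exact_mod_cast Finset.card_le_card hsub
    have hlt2 : 8 * P.card * L.card * ∑ l ∈ L', ((H l).card : ℝ) < L.card * I ^ 2 :=
      hlt.trans_le (by gcongr)
    have hlt3 : 8 * P.card * ∑ l ∈ L', ((H l).card : ℝ) < I ^ 2 := by
      have : (L.card : ℝ) * (8 * P.card * ∑ l ∈ L', ((H l).card : ℝ)) < L.card * I ^ 2 := by
        linarith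
      exact lt_of_mul_lt_mul_left this hLpos.le
    -- P * ΣH ≥ I'^2 - P I' ≥ I'^2/2 ≥ I^2/8
    nlinarith
  obtain ⟨l₀, hl₀, hl₀H⟩ := hex
  set S := H l₀ with hS
  set P₀ := P.filter (fun p => p ∉ l₀) with hP₀
  have hSL : S ⊆ L := (Finset.filter_subset _ _).trans hsub
  have hPP : P₀ ⊆ P := Finset.filter_subset _ _
  set J : ℝ := ∑ l ∈ S, ((P₀.filter (fun p => p ∈ l)).card : ℝ) with hJ
  have s2 : J ^ 2 ≤ P.card * (S.card * (2 * q)) := by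
    have a := aux_cs P₀ S
    have b : ∑ l ∈ S, ∑ l' ∈ S, (P₀.filter (fun p => p ∈ l ∧ p ∈ l')).card ≤
        ∑ l ∈ S, (q + q) := by
      refine Finset.sum_le_sum fun l hl => ?_
      refine (aux_row P₀ S l hl
        fun l' hl' hne x _ y _ => h2 l (hSL hl) l' (hSL hl') hne x y).trans ?_
      have hl2 := (Finset.mem_filter.1 hl).2
      refine add_le_add ?_ ?_
      · refine (Finset.card_le_card ?_).trans (h1 l (hSL hl))
        exact Finset.filter_subset_filter _ hPP
      · refine (Finset.card_le_card ?_).trans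
          (h3 l₀ (hsub hl₀) l (hSL hl) hl2.1 (by obtain ⟨p, _, h⟩ := hl2.2; exact ⟨p, h⟩))
        intro l' hl'
        obtain ⟨hl'S, hne, p, hp, hpl⟩ := Finset.mem_filter.1 hl'
        obtain ⟨_, _, p', _, hp'⟩ := Finset.mem_filter.1 hl'S
        exact Finset.mem_filter.2 ⟨hSL hl'S, ⟨p', hp'⟩, p, (Finset.mem_filter.1 hp).2, hpl⟩
    have c := a.trans (Nat.mul_le_mul (Finset.card_le_card hPP) b)
    have : ((∑ l ∈ S, (P₀.filter (fun p => p ∈ l)).card : ℕ) : ℝ) = J := by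
      rw [hJ]; push_cast; rfl
    have c' : (((∑ l ∈ S, (P₀.filter (fun p => p ∈ l)).card) ^ 2 : ℕ) : ℝ) ≤ _ :=
      Nat.cast_le.2 c
    rw [Nat.cast_pow, this] at c'
    refine c'.trans (le_of_eq ?_)
    rw [Finset.sum_const, smul_eq_mul]
    push_cast; ring
  have s3 : S.card * I ≤ 4 * L.card * J := by
    rw [hJ, Finset.mul_sum, ← nsmul_eq_mul, ← Finset.sum_const]
    refine Finset.sum_le_sum fun l hl => ?_
    obtain ⟨hlL', hne, _⟩ := Finset.mem_filter.1 hl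
    have hr : I ≤ 2 * L.card * k l := (Finset.mem_filter.1 hlL').2
    have hone : (P.filter (fun p => p ∈ l)).card ≤ (P₀.filter (fun p => p ∈ l)).card + 1 := by
      have : P.filter (fun p => p ∈ l) ⊆
          P₀.filter (fun p => p ∈ l) ∪ P.filter (fun p => p ∈ l ∧ p ∈ l₀) := by
        intro x hx
        simp only [hP₀, Finset.mem_union, Finset.mem_filter] at hx ⊢
        tauto
      refine (Finset.card_le_card this).trans ((Finset.card_union_le _ _).trans ?_)
      gcongr
      rw [Finset.card_le_one]
      intro a ha b hb
      simp only [Finset.mem_filter] at ha hb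
      exact h2 l₀ (hsub hl₀) l (hsub hlL') hne a b ha.2.2 ha.2.1 hb.2.2 hb.2.1
    have hone' : k l ≤ ((P₀.filter (fun p => p ∈ l)).card : ℝ) + 1 := by
      simp only [hk]; exact_mod_cast hone
    nlinarith
  have hPpos : (0:ℝ) < P.card := by
    rcases hP0.lt_or_eq with h | h
    · exact h
    · rw [← h] at hl₀H; simp at hl₀H; nlinarith
  have hSpos : (0:ℝ) < S.card := by
    rcases (Nat.cast_nonneg (α := ℝ) S.card).lt_or_eq with h | h
    · exact h
    · rw [← h] at hl₀H; simp at hl₀H; nlinarith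
  have s4 : (S.card * I) ^ 2 ≤ 16 * L.card ^ 2 * (P.card * (S.card * (2 * q))) := by
    calc (S.card * I) ^ 2 ≤ (4 * L.card * J) ^ 2 := by gcongr
      _ = 16 * L.card ^ 2 * J ^ 2 := by ring
      _ ≤ _ := by gcongr
  have s5 : S.card * I ^ 2 ≤ 32 * L.card ^ 2 * P.card * q := by
    refine le_of_mul_le_mul_left ?_ hSpos
    nlinarith
  calc I ^ 4 = I ^ 2 * I ^ 2 := by ring
    _ ≤ (8 * P.card * L.card * S.card) * I ^ 2 := by gcongr
    _ = (8 * P.card * L.card) * (S.card * I ^ 2) := by ring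
    _ ≤ (8 * P.card * L.card) * (32 * L.card ^ 2 * P.card * q) := by gcongr
    _ = _ := by ring

lemma line_through {F : Type*} [Field F] {n : ℕ} {l : Set (Fin n → F)} (hl : IsLine F l)
    {x y : Fin n → F} (hx : x ∈ l) (hy : y ∈ l) (hxy : x ≠ y) :
    l = {z | ∃ t : F, z = x + t • (y - x)} := by
  obtain ⟨a, v, hv, rfl⟩ := hl
  obtain ⟨s, rfl⟩ := hx
  obtain ⟨r, rfl⟩ := hy
  have hrs : r - s ≠ 0 := by
    intro h
    apply hxy
    rw [sub_eq_zero.1 h]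
  ext z
  constructor
  · rintro ⟨t, rfl⟩
    refine ⟨(t - s) / (r - s), ?_⟩
    have : a + r • v - (a + s • v) = (r - s) • v := by module
    rw [this, smul_smul, div_mul_cancel₀ _ hrs]
    module
  · rintro ⟨t, rfl⟩
    exact ⟨s + t * (r - s), by module⟩

open Classical in
lemma geom {F : Type*} [Field F] [Fintype F] {n : ℕ} (L : Finset (Set (Fin n → F)))
    (hL : ∀ l ∈ L, IsLine F l) (hD : DiffDirections F (L : Set (Set (Fin n → F))))
    (l₀ : Set (Fin n → F)) (hl₀ : l₀ ∈ L) (l : Set (Fin n → F)) (hl : l ∈ L) (hne : l ≠ l₀)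
    (hm : ∃ p, p ∈ l₀ ∧ p ∈ l) :
    (L.filter (fun l' => (∃ p, p ∈ l₀ ∧ p ∈ l') ∧
        ∃ p, p ∉ l₀ ∧ p ∈ l ∧ p ∈ l')).card ≤ Fintype.card F := by
  obtain ⟨a, ha0, ha⟩ := hm
  have par : ∀ l, IsLine F l → a ∈ l → ∃ v, l = {z | ∃ t : F, z = a + t • v} := by
    rintro l ⟨x, v, hv, rfl⟩ ⟨s, rfl⟩
    refine ⟨v, ?_⟩
    ext z
    constructor
    · rintro ⟨t, rfl⟩
      exact ⟨t - s, by module⟩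
    · rintro ⟨t, rfl⟩
      exact ⟨s + t, by module⟩
  obtain ⟨v₀, hv₀⟩ := par l₀ (hL _ hl₀) ha0
  obtain ⟨v, hv⟩ := par l (hL _ hl) ha
  have key : ∀ l' ∈ L.filter (fun l' => (∃ p, p ∈ l₀ ∧ p ∈ l') ∧
        ∃ p, p ∉ l₀ ∧ p ∈ l ∧ p ∈ l'), ∃ s : F, ∃ x,
        l' = {z | ∃ t : F, z = x + t • (v - s • v₀)} := by
    intro l' hl'
    obtain ⟨hl'L, ⟨p, hp0, hp⟩, p', hp'0, hp'l, hp'⟩ := Finset.mem_filter.1 hl'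
    have hpp : p ≠ p' := fun h => hp'0 (h ▸ hp0)
    have e := line_through (hL _ hl'L) hp hp' hpp
    rw [hv₀] at hp0
    rw [hv] at hp'l
    obtain ⟨s, hs⟩ := hp0
    obtain ⟨r, hr⟩ := hp'l
    have hr0 : r ≠ 0 := by
      rintro rfl
      apply hp'0
      rw [hr]; simpa using ha0
    refine ⟨s / r, p, ?_⟩
    have hd : p' - p = r • (v - (s / r) • v₀) := by
      rw [smul_sub, smul_smul, mul_div_cancel₀ _ hr0, hr, hs]
      module
    rw [e, hd]
    ext z
    constructor
    · rintro ⟨t, rfl⟩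
      exact ⟨t * r, by rw [smul_smul]⟩
    · rintro ⟨t, rfl⟩
      exact ⟨t / r, by rw [smul_smul, div_mul_cancel₀ _ hr0]⟩
  choose! f hf using key
  rw [← Finset.card_univ]
  refine Finset.card_le_card_of_injOn f (fun _ _ => Finset.mem_coe.2 (Finset.mem_univ _)) ?_
  intro l1 h1 l2 h2 h12
  by_contra hcon
  obtain ⟨x1, e1⟩ := hf l1 h1
  obtain ⟨x2, e2⟩ := hf l2 h2
  refine hD l1 (Finset.mem_filter.1 h1).1 l2 (Finset.mem_filter.1 h2).1 hcon ⟨x2 - x1, ?_⟩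
  rw [e1, e2, ← h12]
  ext z
  simp only [Set.mem_setOf_eq, Set.mem_image]
  constructor
  · rintro ⟨t, rfl⟩
    exact ⟨_, ⟨t, rfl⟩, by module⟩
  · rintro ⟨_, ⟨t, rfl⟩, rfl⟩
    exact ⟨t, by module⟩

/-- Wolff-type incidence bound for lines in different directions. -/
theorem incidence_bound_wolff :
    ∀ n : ℕ, ∃ C : ℝ, 0 < C ∧
      ∀ (F : Type) [Field F] [Fintype F], 2 < ringChar F →
        ∀ (P : Set (Fin n → F)) (L : Set (Set (Fin n → F))),
          (∀ l ∈ L, IsLine F l) → DiffDirections F L →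
          ({pl : (Fin n → F) × Set (Fin n → F) |
              pl.1 ∈ P ∧ pl.2 ∈ L ∧ pl.1 ∈ pl.2}.ncard : ℝ) ≤
            C * ((P.ncard : ℝ) ^ ((1 : ℝ) / 2) * (L.ncard : ℝ) ^ ((3 : ℝ) / 4) *
                  (Fintype.card F : ℝ) ^ ((1 : ℝ) / 4) +
                (P.ncard : ℝ) + (L.ncard : ℝ)) := by
  classical
  intro n
  refine ⟨4, by norm_num, ?_⟩
  intro F _ _ _ P L hL hD
  obtain ⟨P, rfl⟩ : ∃ P' : Finset (Fin n → F), P = ↑P' := ⟨P.toFinset, by simp⟩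
  obtain ⟨L, rfl⟩ : ∃ L' : Finset (Set (Fin n → F)), L = ↑L' :=
    ⟨(Set.toFinite L).toFinset, by simp⟩
  rw [Set.ncard_coe_finset, Set.ncard_coe_finset]
  set I : ℝ := ({pl : (Fin n → F) × Set (Fin n → F) |
              pl.1 ∈ (P : Set (Fin n → F)) ∧ pl.2 ∈ (L : Set (Set (Fin n → F))) ∧
              pl.1 ∈ pl.2}.ncard : ℝ) with hIdef
  have hI : I = ∑ l ∈ L, ((P.filter (fun p => p ∈ l)).card : ℝ) := by
    have : {pl : (Fin n → F) × Set (Fin n → F) |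
              pl.1 ∈ (P : Set (Fin n → F)) ∧ pl.2 ∈ (L : Set (Set (Fin n → F))) ∧
              pl.1 ∈ pl.2} = ↑((P ×ˢ L).filter (fun pl => pl.1 ∈ pl.2)) := by
      ext ⟨p, l⟩
      simp [and_assoc]
    rw [hIdef, this, Set.ncard_coe_finset, Finset.card_filter, Finset.sum_product_right]
    push_cast
    refine Finset.sum_congr rfl fun l _ => ?_
    rw [Finset.card_filter]
    push_cast
    rfl
  have hX : (0:ℝ) ≤ (P.card : ℝ) ^ ((1 : ℝ) / 2) * (L.card : ℝ) ^ ((3 : ℝ) / 4) *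
                  (Fintype.card F : ℝ) ^ ((1 : ℝ) / 4) := by positivity
  have hP0 : (0:ℝ) ≤ P.card := by positivity
  have hL0 : (0:ℝ) ≤ L.card := by positivity
  rcases le_or_gt I (4 * (P.card : ℝ)) with h | hP
  · linarith
  rcases le_or_gt I (4 * (L.card : ℝ)) with h | hLc
  · linarith
  have main := aux_comb P L (Fintype.card F) ?_ ?_
    (by convert geom L (fun l hl => hL l hl) hD) I (by convert hI) hP hLc
  · have : I ≤ 4 * ((P.card : ℝ) ^ ((1 : ℝ) / 2) * (L.card : ℝ) ^ ((3 : ℝ) / 4) *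
                  (Fintype.card F : ℝ) ^ ((1 : ℝ) / 4)) := by
      refine le_of_pow_le_pow_left₀ (n := 4) (by norm_num) (by positivity) ?_
      refine main.trans (le_of_eq ?_)
      rw [mul_pow, mul_pow, mul_pow, ← Real.rpow_mul_natCast (by positivity),
        ← Real.rpow_mul_natCast (by positivity), ← Real.rpow_mul_natCast (by positivity)]
      norm_num
    linarith
  · intro l hl
    obtain ⟨x, v, hv, e⟩ := hL l hl
    rw [← Finset.card_univ]
    refine (Finset.card_le_card (t := Finset.univ.image (fun t : F => x + t • v)) ?_).trans
      Finset.card_image_le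
    intro y hy
    have hy' := (Finset.mem_filter.1 hy).2
    rw [e] at hy'
    obtain ⟨t, rfl⟩ := hy'
    simp
  · intro l hl l' hl' hne x y hx hx' hy hy'
    by_contra hxy
    exact hne ((line_through (hL _ hl') hx' hy' hxy).trans
      (line_through (hL _ hl) hx hy hxy).symm)
end

section
/- For every ε > 0 there exists C(ε) > 0 such that the following holds. Let F be a finite field with char(F) > 2, let L be a family of lines in F^4 pointing in different directions such that every point of F^4 lies on at most μ lines of L, let P ⊆ F^4 contain every line of L, and let f1, f2, f3 be frames in F^4 whose 3-dimensional affine subspaces λ(f1), λ(f2), λ(f3) are pairwise translates of one another (possibly equal) and whose reguli r(f1), r(f2), r(f3) are pairwise distinct. Then the number of lines l ∈ L with l ∩ r(fi) ∩ P ≠ ∅ for all i = 1, 2, 3 is at most C(ε)·|F|^ε·(|F|² + |P|/|F| + μ·|F|). -/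
open Set

section Aux
open Finset Pointwise

lemma greedy_step {G : Type*} [AddCommGroup G] [Fintype G] [DecidableEq G] (U A : Finset G)
    (hA : 2 * #A < Fintype.card G) : ∃ b : G, #U ≤ 2 * #{u ∈ U | b + u ∉ A} := by
  by_contra! h
  have h1 : ∑ b : G, #{u ∈ U | b + u ∉ A} = #U * #Aᶜ := by
    simp only [card_filter]
    rw [sum_comm, ← smul_eq_mul, ← sum_const]
    refine sum_congr rfl fun u _ => ?_
    rw [← card_filter]
    refine card_bij (fun b _ => b + u) ?_ ?_ ?_
    · intro a ha; simpa using ha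
    · intro a _ b _ hab; simpa using hab
    · intro b hb; exact ⟨b - u, by simpa using hb, by simp⟩
  have h2 : ∑ b : G, 2 * #{u ∈ U | b + u ∉ A} < ∑ b : G, #U :=
    sum_lt_sum_of_nonempty ⟨0, mem_univ _⟩ fun b _ => h b
  rw [← mul_sum, h1, sum_const, smul_eq_mul, card_univ] at h2
  have h3 := card_add_card_compl A
  have : #U * (2 * #Aᶜ) < #U * Fintype.card G := by nlinarith
  have := lt_of_mul_lt_mul_left' this
  omega

lemma greedy {G : Type*} [AddCommGroup G] [Fintype G] [DecidableEq G] (U : Finset G) (M : ℕ) :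
    ∃ B : Finset G, #B ≤ M ∧ min (Fintype.card G) (M * #U) ≤ 2 * #(B + U) := by
  induction M with
  | zero => exact ⟨∅, by simp⟩
  | succ M ih =>
    obtain ⟨B, hB, h⟩ := ih
    by_cases hA : 2 * #(B + U) < Fintype.card G
    · obtain ⟨b, hb⟩ := greedy_step U (B + U) hA
      refine ⟨insert b B, (card_insert_le _ _).trans (by omega), ?_⟩
      have h1 : #(B + U) + #{u ∈ U | b + u ∉ B + U} ≤ #(insert b B + U) := by
        rw [← Finset.card_image_of_injective {u ∈ U | b + u ∉ B + U} (add_right_injective b),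
          ← card_union_of_disjoint]
        · apply Finset.card_le_card
          intro x hx
          rw [Finset.mem_union] at hx
          rcases hx with hx | hx
          · exact Finset.add_subset_add_right (Finset.subset_insert _ _) hx
          · obtain ⟨u, hu, rfl⟩ := Finset.mem_image.1 hx
            exact Finset.add_mem_add (Finset.mem_insert_self _ _) (mem_filter.1 hu).1
        · rw [Finset.disjoint_right]
          intro x hx
          obtain ⟨u, hu, rfl⟩ := Finset.mem_image.1 hx
          exact (mem_filter.1 hu).2
      have : M * #U ≤ 2 * #(B + U) := by
        rcases min_le_iff.1 h with h | h
        · omega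
        · exact h
      refine (min_le_right _ _).trans ?_
      rw [add_mul]; omega
    · exact ⟨B, by omega, (min_le_left _ _).trans (by omega)⟩

lemma coeff_prod_lin {F ι : Type*} [Field F] (s : Finset ι) (x v : ι → F) (m : ι → ℕ) :
    (∏ i ∈ s, (Polynomial.C (x i) + Polynomial.X * Polynomial.C (v i)) ^ m i).natDegree
      ≤ ∑ i ∈ s, m i ∧
    (∏ i ∈ s, (Polynomial.C (x i) + Polynomial.X * Polynomial.C (v i)) ^ m i).coeff
      (∑ i ∈ s, m i) = ∏ i ∈ s, v i ^ m i := by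
  classical
  have hl : ∀ i, (Polynomial.C (x i) + Polynomial.X * Polynomial.C (v i)).natDegree ≤ 1 := by
    intro i; compute_degree
  have hp : ∀ i, ((Polynomial.C (x i) + Polynomial.X * Polynomial.C (v i)) ^ m i).natDegree
      ≤ m i := by
    intro i
    exact (Polynomial.natDegree_pow_le_of_le _ (hl i)).trans (by simp)
  have hc : ∀ i, ((Polynomial.C (x i) + Polynomial.X * Polynomial.C (v i)) ^ m i).coeff (m i)
      = v i ^ m i := by
    intro i
    have := Polynomial.coeff_pow_of_natDegree_le (m := m i) (hl i)
    simp [-Polynomial.X_mul_C] at this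
    rw [this]
  induction s using Finset.induction_on with
  | empty => simp
  | insert a s ha ih =>
    rw [prod_insert ha, sum_insert ha, prod_insert ha]
    refine ⟨Polynomial.natDegree_mul_le_of_le (hp a) ih.1, ?_⟩
    rw [Polynomial.coeff_mul_add_eq_of_natDegree_le (hp a) ih.1, hc, ih.2]

lemma top_vanish {F : Type*} [Field F] [Fintype F] {n : ℕ} (f : MvPolynomial (Fin n) F)
    (hf : f.totalDegree < Fintype.card F) (x v : Fin n → F)
    (h : ∀ t : F, MvPolynomial.eval (x + t • v) f = 0) :
    MvPolynomial.eval v (MvPolynomial.homogeneousComponent f.totalDegree f) = 0 := by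
  classical
  set p : Polynomial F := ∑ m ∈ f.support, Polynomial.C (f.coeff m) *
    ∏ i, (Polynomial.C (x i) + Polynomial.X * Polynomial.C (v i)) ^ m i with hp
  have hsum : ∀ m : Fin n →₀ ℕ, ∑ i, m i = m.degree := fun m => (Finsupp.degree_eq_sum m).symm
  have hle : ∀ m ∈ f.support, ∑ i, m i ≤ f.totalDegree := by
    intro m hm
    rw [hsum]
    exact MvPolynomial.le_totalDegree hm
  have hdeg : p.natDegree ≤ f.totalDegree := by
    refine Polynomial.natDegree_sum_le_of_forall_le _ _ fun m hm => ?_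
    exact (Polynomial.natDegree_C_mul_le _ _).trans
      ((coeff_prod_lin univ x v m).1.trans (hle m hm))
  have hev : ∀ t, p.eval t = 0 := by
    intro t
    rw [← h t, MvPolynomial.eval_eq', hp, Polynomial.eval_finsetSum]
    refine sum_congr rfl fun m _ => ?_
    simp [Polynomial.eval_prod, mul_comm t]
  have hp0 : p = 0 := by
    refine Polynomial.eq_zero_of_natDegree_lt_card_of_eval_eq_zero p
      (f := (id : F → F)) Function.injective_id hev (by omega)
  have hc : p.coeff f.totalDegree = 0 := by rw [hp0]; simp
  rw [hp, Polynomial.finsetSum_coeff] at hc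
  rw [MvPolynomial.homogeneousComponent_apply, map_sum, ← hc, sum_filter]
  refine sum_congr rfl fun m hm => ?_
  rw [Polynomial.coeff_C_mul]
  split_ifs with hd
  · have := (coeff_prod_lin univ x v m).2
    rw [hsum, hd] at this
    rw [this, MvPolynomial.eval_monomial, Finsupp.prod_fintype _ _ (by simp)]
  · rw [Polynomial.coeff_eq_zero_of_natDegree_lt, mul_zero]
    refine (coeff_prod_lin univ x v m).1.trans_lt (lt_of_le_of_ne (hle m hm) ?_)
    rwa [hsum]

lemma exists_poly {F : Type*} [Field F] [DecidableEq F] (P : Finset (Fin 4 → F)) (e : ℕ)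
    (he : #P < e ^ 4) : ∃ f : MvPolynomial (Fin 4) F, f ≠ 0 ∧ f.totalDegree ≤ 4 * (e - 1) ∧
      ∀ x ∈ P, MvPolynomial.eval x f = 0 := by
  classical
  let ex : (Fin 4 → Fin e) → (Fin 4 →₀ ℕ) := fun m => Finsupp.equivFunOnFinite.symm fun i => (m i : ℕ)
  have hex : Function.Injective ex := by
    intro a b hab
    have := Finsupp.equivFunOnFinite.symm.injective hab
    funext i
    exact Fin.ext (congrFun this i)
  let Φ : ((Fin 4 → Fin e) → F) →ₗ[F] MvPolynomial (Fin 4) F :=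
    Fintype.linearCombination F fun m => MvPolynomial.monomial (ex m) (1 : F)
  let E : MvPolynomial (Fin 4) F →ₗ[F] (P → F) :=
    LinearMap.pi fun x => (MvPolynomial.aeval (x : Fin 4 → F)).toLinearMap
  have hk : LinearMap.ker (E ∘ₗ Φ) ≠ ⊥ := by
    apply LinearMap.ker_ne_bot_of_finrank_lt
    simpa using he
  obtain ⟨c, hc, hc0⟩ := (Submodule.ne_bot_iff _).1 hk
  have hΦ : Φ c = ∑ m, MvPolynomial.monomial (ex m) (c m) := by
    simp [Φ, Fintype.linearCombination_apply, MvPolynomial.smul_monomial]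
  refine ⟨Φ c, ?_, ?_, ?_⟩
  · intro h0
    apply hc0
    funext m
    have := congrArg (MvPolynomial.coeff (ex m)) h0
    rw [hΦ, MvPolynomial.coeff_sum] at this
    simpa [MvPolynomial.coeff_monomial, hex.eq_iff] using this
  · rw [hΦ]
    refine MvPolynomial.totalDegree_finsetSum_le fun m _ => ?_
    refine (MvPolynomial.totalDegree_monomial_le _ _).trans ?_
    rw [Finsupp.sum_fintype _ _ (by simp)]
    have : ∀ i, ex m i ≤ e - 1 := fun i => by
      have := (m i).2
      simp [ex]; omega
    exact (Finset.sum_le_sum fun i _ => this i).trans (by simp)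
  · intro x hx
    have := congrFun (LinearMap.mem_ker.1 hc) ⟨x, hx⟩
    simpa [E, MvPolynomial.aeval_eq_eval] using this

lemma dvir {F : Type*} [Field F] [Fintype F] [DecidableEq F] (P D : Finset (Fin 4 → F))
    (i : Fin 4) (e : ℕ) (he : 8 * (e - 1) < Fintype.card F - 1)
    (hD : ∀ v ∈ D, v i = 1 ∧ ∃ x, ∀ t : F, x + t • v ∈ P)
    (hD2 : Fintype.card F ^ 3 ≤ 2 * #D) : e ^ 4 ≤ #P := by
  classical
  by_contra! hP
  obtain ⟨f, hf0, hfd, hfP⟩ := exists_poly P e hP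
  set q := Fintype.card F with hq
  set g := MvPolynomial.homogeneousComponent f.totalDegree f with hg
  have hg0 : g ≠ 0 := by
    obtain ⟨m, hm, hme⟩ := Finset.exists_mem_eq_sup f.support
      (MvPolynomial.support_nonempty.2 hf0) (fun m => m.sum fun _ k => k)
    intro h0
    have h1 := congrArg (MvPolynomial.coeff m) h0
    have h2 : m.degree = f.totalDegree := hme.symm
    rw [hg, MvPolynomial.coeff_homogeneousComponent, if_pos h2, MvPolynomial.coeff_zero] at h1
    exact MvPolynomial.mem_support_iff.1 hm h1
  have hgh : g.IsHomogeneous f.totalDegree := MvPolynomial.homogeneousComponent_isHomogeneous _ _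
  have hgD : ∀ v ∈ D, ∀ τ : F, MvPolynomial.eval (τ • v) g = 0 := by
    intro v hv τ
    obtain ⟨_, x, hx⟩ := hD v hv
    exact top_vanish f (by omega) x (τ • v) fun t => hfP _ (by rw [smul_smul]; exact hx _)
  have hsz := MvPolynomial.schwartz_zippel_totalDegree hg0 (univ : Finset F)
  have hcard : (q - 1) * #D ≤ #{f ∈ Fintype.piFinset fun _ : Fin 4 ↦ (univ : Finset F) | MvPolynomial.eval f g = 0} := by
    have : q - 1 = #((univ : Finset F).erase 0) := by simp [hq]
    rw [this, ← card_product]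
    refine card_le_card_of_injOn (fun p => p.1 • p.2) ?_ ?_
    · rintro ⟨τ, v⟩ h
      simp only [coe_product, Set.mem_prod, mem_coe] at h
      simp only [mem_coe, mem_filter, Fintype.mem_piFinset, Finset.mem_univ, implies_true, true_and]
      exact hgD v h.2 τ
    · rintro ⟨τ, v⟩ h ⟨τ', v'⟩ h' hh
      simp only [coe_product, Set.mem_prod, mem_coe, mem_erase] at h h'
      simp only at hh
      have h1 := congrFun hh i
      simp [(hD v h.2).1, (hD v' h'.2).1] at h1
      subst h1
      have := smul_right_injective (Fin 4 → F) h.1.1 hh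
      simp_all
  have hq2 : 0 < q := Fintype.card_pos
  rw [hgh.totalDegree hg0, card_univ, div_le_div_iff₀ (by positivity) (by positivity)] at hsz
  have h2 : #{f ∈ Fintype.piFinset fun _ : Fin 4 ↦ (univ : Finset F) | MvPolynomial.eval f g = 0} * q ≤ f.totalDegree * q ^ 4 := by
    exact_mod_cast hsz
  have h3 : #{f ∈ Fintype.piFinset fun _ : Fin 4 ↦ (univ : Finset F) | MvPolynomial.eval f g = 0} ≤ f.totalDegree * q ^ 3 := by
    refine Nat.le_of_mul_le_mul_right ?_ hq2
    calc _ ≤ _ := h2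
      _ = _ := by ring
  have h4 : (q - 1) * q ^ 3 ≤ 2 * f.totalDegree * q ^ 3 := by
    calc (q - 1) * q ^ 3 ≤ (q - 1) * (2 * #D) := by gcongr
      _ = 2 * ((q - 1) * #D) := by ring
      _ ≤ 2 * (f.totalDegree * q ^ 3) := Nat.mul_le_mul_left _ (hcard.trans h3)
      _ = _ := by ring
  have h5 := Nat.le_of_mul_le_mul_right h4 (by positivity)
  omega

lemma kak {F : Type*} [Field F] [Fintype F] [DecidableEq F] (P : Finset (Fin 4 → F))
    (i : Fin 4) (U : Finset (Fin 3 → F))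
    (hU : ∀ u ∈ U, ∃ x : Fin 4 → F, ∀ t : F, x + t • (i.insertNth 1 u : Fin 4 → F) ∈ P) :
    #U * Fintype.card F ≤ 131072 * #P := by
  classical
  set q := Fintype.card F with hq
  have hq2 : 1 < q := Fintype.one_lt_card
  rcases U.eq_empty_or_nonempty with rfl | hne
  · simp
  have hU0 : 0 < #U := hne.card_pos
  have hG : Fintype.card (Fin 3 → F) = q ^ 3 := by simp [hq]
  have hUle : #U ≤ q ^ 3 := hG ▸ card_le_univ U
  set M := q ^ 3 / #U + 1 with hM
  have hM1 : q ^ 3 ≤ M * #U := by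
    have := Nat.lt_div_mul_add (a := q ^ 3) hU0
    rw [hM, add_mul]; omega
  have hM2 : M * #U ≤ 2 * q ^ 3 := by
    have := Nat.div_mul_le_self (q ^ 3) #U
    rw [hM, add_mul]; omega
  obtain ⟨B, hB, hBU⟩ := greedy U M
  rw [hG, min_eq_left hM1] at hBU
  let sh : (Fin 3 → F) → (Fin 4 → F) → (Fin 4 → F) :=
    fun b x => x + x i • (i.insertNth 0 b : Fin 4 → F)
  set P' := image₂ sh B P with hP'
  set D : Finset (Fin 4 → F) := (B + U).image (fun u => (i.insertNth 1 u : Fin 4 → F)) with hD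
  have hDc : #D = #(B + U) := by
    apply Finset.card_image_of_injective
    exact Fin.insertNth_right_injective (α := fun _ => F) (p := i) 1
  set e := (q - 2) / 8 + 1 with he
  have key : e ^ 4 ≤ #P' := by
    refine dvir P' D i e (by omega) ?_ (by rw [hDc]; exact hBU)
    intro v hv
    obtain ⟨w, hw, rfl⟩ := mem_image.1 hv
    obtain ⟨b, hb, u, hu, rfl⟩ := mem_add.1 hw
    refine ⟨by simp, ?_⟩
    obtain ⟨x, hx⟩ := hU u hu
    refine ⟨sh b x, fun t => ?_⟩
    have : sh b x + t • (i.insertNth 1 (b + u) : Fin 4 → F)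
        = sh b (x + t • (i.insertNth 1 u : Fin 4 → F)) := by
      funext j
      refine Fin.succAboveCases i ?_ (fun j => ?_) j
      · simp [sh]
      · simp [sh]; ring
    rw [this]
    exact mem_image₂_of_mem hb (hx t)
  have hP'c : #P' ≤ M * #P := (card_image₂_le _ _ _).trans (Nat.mul_le_mul_right _ hB)
  have h16 : q ≤ 16 * e := by omega
  have h1 : q ^ 4 ≤ 65536 * e ^ 4 := by
    calc q ^ 4 ≤ (16 * e) ^ 4 := Nat.pow_le_pow_left h16 4
      _ = _ := by ring
  have h2 : q ^ 3 * (#U * q) ≤ q ^ 3 * (131072 * #P) := by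
    calc q ^ 3 * (#U * q) = q ^ 4 * #U := by ring
      _ ≤ (65536 * (M * #P)) * #U :=
        Nat.mul_le_mul_right _ (h1.trans (Nat.mul_le_mul_left _ (key.trans hP'c)))
      _ = 65536 * #P * (M * #U) := by ring
      _ ≤ 65536 * #P * (2 * q ^ 3) := Nat.mul_le_mul_left _ hM2
      _ = _ := by ring
  exact Nat.le_of_mul_le_mul_left h2 (by positivity)

lemma kakeya_lines {F : Type*} [Field F] [Fintype F] (L : Set (Set (Fin 4 → F)))
    (hL : ∀ l ∈ L, IsLine F l) (hd : DiffDirections F L) (P : Set (Fin 4 → F))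
    (hP : ∀ l ∈ L, l ⊆ P) : L.ncard * Fintype.card F ≤ 524288 * P.ncard := by
  classical
  choose! x v hv hl using hL
  let Pf := P.toFinite.toFinset
  have hPf : #Pf = P.ncard := (Set.ncard_eq_toFinset_card P).symm
  let Lf := L.toFinite.toFinset
  have hLf : #Lf = L.ncard := (Set.ncard_eq_toFinset_card L).symm
  have hmem : ∀ l, l ∈ Lf ↔ l ∈ L := fun l => by simp [Lf]
  have hS : ∀ i : Fin 4, #{l ∈ Lf | v l i ≠ 0} * Fintype.card F ≤ 131072 * #Pf := by
    intro i
    let w : Set (Fin 4 → F) → (Fin 3 → F) := fun l => i.removeNth ((v l i)⁻¹ • v l)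
    have hw : ∀ l, v l i ≠ 0 → (i.insertNth 1 (w l) : Fin 4 → F) = (v l i)⁻¹ • v l := by
      intro l h
      rw [Fin.insertNth_eq_iff]
      simp [w, h]
    have hc : #(image w {l ∈ Lf | v l i ≠ 0}) = #{l ∈ Lf | v l i ≠ 0} := by
      apply card_image_of_injOn
      intro l h l' h' hll
      simp only [coe_filter, Set.mem_ofPred_eq, hmem] at h h'
      by_contra hne
      refine hd l h.1 l' h'.1 hne ⟨x l' - x l, ?_⟩
      have e1 : (v l i)⁻¹ • v l = (v l' i)⁻¹ • v l' := by
        rw [← hw l h.2, ← hw l' h'.2, hll]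
      have e2 : v l' = (v l' i * (v l i)⁻¹) • v l := by
        rw [mul_smul, e1, smul_smul, mul_inv_cancel₀ h'.2, one_smul]
      have e3 : v l = (v l i * (v l' i)⁻¹) • v l' := by
        rw [mul_smul, ← e1, smul_smul, mul_inv_cancel₀ h.2, one_smul]
      ext y
      constructor
      · intro hy
        rw [hl l' h'.1] at hy
        obtain ⟨t, rfl⟩ := hy
        refine ⟨x l + (t * (v l' i * (v l i)⁻¹)) • v l, ?_, ?_⟩
        · have : ∀ s : F, x l + s • v l ∈ l := fun s => by
            have h0 := hl l h.1
            have : x l + s • v l ∈ {y | ∃ t : F, y = x l + t • v l} := ⟨s, rfl⟩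
            rw [← h0] at this
            exact this
          exact this _
        · rw [mul_smul, ← e2]
          simp only
          abel
      · rintro ⟨z, hz, rfl⟩
        rw [hl l h.1] at hz
        obtain ⟨t, rfl⟩ := hz
        have : ∀ s : F, x l' + s • v l' ∈ l' := fun s => by
          have h0 := hl l' h'.1
          have : x l' + s • v l' ∈ {y | ∃ t : F, y = x l' + t • v l'} := ⟨s, rfl⟩
          rw [← h0] at this
          exact this
        have h3 := this (t * (v l i * (v l' i)⁻¹))
        rw [mul_smul, ← e3] at h3
        convert h3 using 1
        simp only
        abel
    rw [← hc]
    refine kak Pf i _ ?_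
    intro u hu
    obtain ⟨l, hlm, rfl⟩ := mem_image.1 hu
    rw [mem_filter, hmem] at hlm
    refine ⟨x l, fun t => ?_⟩
    rw [hw l hlm.2, smul_smul]
    simp only [Pf, Set.Finite.mem_toFinset]
    apply hP l hlm.1
    have h0 := hl l hlm.1
    have : x l + (t * (v l i)⁻¹) • v l ∈ {y | ∃ t : F, y = x l + t • v l} := ⟨_, rfl⟩
    rw [← h0] at this
    exact this
  have hcov : #Lf ≤ ∑ i : Fin 4, #{l ∈ Lf | v l i ≠ 0} := by
    refine (card_le_card ?_).trans card_biUnion_le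
    intro l h
    obtain ⟨i, hi⟩ := Function.ne_iff.1 (hv l ((hmem l).1 h))
    exact mem_biUnion.2 ⟨i, mem_univ _, mem_filter.2 ⟨h, hi⟩⟩
  rw [← hLf, ← hPf]
  calc #Lf * Fintype.card F ≤ (∑ i : Fin 4, #{l ∈ Lf | v l i ≠ 0}) * Fintype.card F :=
        Nat.mul_le_mul_right _ hcov
    _ = ∑ i : Fin 4, #{l ∈ Lf | v l i ≠ 0} * Fintype.card F := by rw [sum_mul]
    _ ≤ ∑ i : Fin 4, 131072 * #Pf := sum_le_sum fun i _ => hS i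
    _ = 524288 * #Pf := by simp; ring

end Aux

/-- three regulus lemma, general form: frames whose 3-spaces are
pairwise translates (possibly equal) and whose reguli are pairwise distinct. -/
theorem three_regulus_lemma_general :
    ∀ ε : ℝ, 0 < ε → ∃ C : ℝ, 0 < C ∧
      ∀ (F : Type) [Field F] [Fintype F], 2 < ringChar F →
        ∀ (L : Set (Set (Fin 4 → F))) (μ : ℕ),
          (∀ l ∈ L, IsLine F l) → DiffDirections F L →
          (∀ p : Fin 4 → F, {l ∈ L | p ∈ l}.ncard ≤ μ) →
          ∀ P : Set (Fin 4 → F), (∀ l ∈ L, l ⊆ P) →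
            ∀ a₁ b₁ c₁ lam₁ a₂ b₂ c₂ lam₂ a₃ b₃ c₃ lam₃ : Set (Fin 4 → F),
              IsFrame F a₁ b₁ c₁ lam₁ → IsFrame F a₂ b₂ c₂ lam₂ →
              IsFrame F a₃ b₃ c₃ lam₃ →
              IsTranslate F lam₁ lam₂ → IsTranslate F lam₁ lam₃ →
              IsTranslate F lam₂ lam₃ →
              regulus F a₁ b₁ c₁ ≠ regulus F a₂ b₂ c₂ →
              regulus F a₁ b₁ c₁ ≠ regulus F a₃ b₃ c₃ →
              regulus F a₂ b₂ c₂ ≠ regulus F a₃ b₃ c₃ →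
              ({l ∈ L | (l ∩ regulus F a₁ b₁ c₁ ∩ P).Nonempty ∧
                  (l ∩ regulus F a₂ b₂ c₂ ∩ P).Nonempty ∧
                  (l ∩ regulus F a₃ b₃ c₃ ∩ P).Nonempty}.ncard : ℝ) ≤
                C * (Fintype.card F : ℝ) ^ ε *
                  ((Fintype.card F : ℝ) ^ (2 : ℕ) +
                    (P.ncard : ℝ) / (Fintype.card F : ℝ) +
                    (μ : ℝ) * (Fintype.card F : ℝ)) := by
  intro ε hε
  refine ⟨524288, by norm_num, ?_⟩
  intro F _ _ _ L μ hL hd _ P hP a₁ b₁ c₁ lam₁ a₂ b₂ c₂ lam₂ a₃ b₃ c₃ lam₃ _ _ _ _ _ _ _ _ _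
  set S := {l ∈ L | (l ∩ regulus F a₁ b₁ c₁ ∩ P).Nonempty ∧
                  (l ∩ regulus F a₂ b₂ c₂ ∩ P).Nonempty ∧
                  (l ∩ regulus F a₃ b₃ c₃ ∩ P).Nonempty} with hS
  have hSL : S ⊆ L := fun l hl => hl.1
  have key := kakeya_lines S (fun l hl => hL l (hSL hl))
    (fun l₁ h₁ l₂ h₂ => hd l₁ (hSL h₁) l₂ (hSL h₂)) P (fun l hl => hP l (hSL hl))
  have hq : (1 : ℝ) ≤ (Fintype.card F : ℝ) := by
    exact_mod_cast (Fintype.card_pos : 0 < Fintype.card F)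
  have hq0 : (0 : ℝ) < (Fintype.card F : ℝ) := by linarith
  have hqe : (1 : ℝ) ≤ (Fintype.card F : ℝ) ^ ε := Real.one_le_rpow hq hε.le
  have key' : (S.ncard : ℝ) * (Fintype.card F : ℝ) ≤ 524288 * (P.ncard : ℝ) := by
    exact_mod_cast key
  have h1 : (S.ncard : ℝ) ≤ 524288 * ((P.ncard : ℝ) / (Fintype.card F : ℝ)) := by
    rw [← mul_div_assoc, le_div_iff₀ hq0]
    exact key'
  calc (S.ncard : ℝ) ≤ 524288 * 1 * ((P.ncard : ℝ) / (Fintype.card F : ℝ)) := by linarith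
    _ ≤ _ := by
      gcongr
      have : (0 : ℝ) ≤ (μ : ℝ) * (Fintype.card F : ℝ) := by positivity
      have : (0 : ℝ) ≤ (Fintype.card F : ℝ) ^ (2 : ℕ) := by positivity
      linarith
end
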